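/- Let W = {W_x}_{x∈𝒳} be a classical-quantum channel with outputs on a finite-dimensional Hilbert space B and let r ≥ 0. Then for all n ≥ |B| one has 1 − ε^NS(W^⊗n, e^{nr}) ≥ (1/2)·exp(−|B| − |𝒳| log(n+1) − 32 n^{4/5} |B|^{1/5} log(|B|(n+|B|))) · inf_{α ∈ [1/2,1]} exp(−n·((1−α)/α)·(Ĩ_α(W) − r)). Consequently limsup_{n→∞} −(1/n) log(1 − ε^NS(W^⊗n, e^{nr})) ≤ sup_{α ∈ [1/2,1]} ((1−α)/α)·(Ĩ_α(W) − r). -/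

import Mathlib

noncomputable section
open scoped BigOperators
open Classical
open scoped ComplexOrder

namespace ChannelSim

/-! ### Classical definitions -/

/-- A probability distribution on a finite type. -/
def IsProbDist {Y : Type*} [Fintype Y] (p : Y → ℝ) : Prop :=
  (∀ y, 0 ≤ p y) ∧ ∑ y, p y = 1

/-- A classical channel: a stochastic matrix, i.e. each row is a probability distribution. -/
def IsChannel {X Y : Type*} [Fintype Y] (W : X → Y → ℝ) : Prop :=
  ∀ x, IsProbDist (W x)

/-- The `n`-fold product channel `W^{⊗n}`. -/
def prodChannel {X Y : Type*} (W : X → Y → ℝ) (n : ℕ) :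
    (Fin n → X) → (Fin n → Y) → ℝ :=
  fun xs ys => ∏ i, W (xs i) (ys i)

/-- The `n`-fold product distribution `q^{⊗n}`. -/
def prodDist {Y : Type*} (q : Y → ℝ) (n : ℕ) : (Fin n → Y) → ℝ :=
  fun ys => ∏ i, q (ys i)

/-- Fidelity of probability distributions on a finite type. -/
def cFid {Y : Type*} [Fintype Y] (p q : Y → ℝ) : ℝ :=
  (∑ y, Real.sqrt (p y * q y)) ^ 2

/-- Purified distance of probability distributions on a finite type. -/
def cPD {Y : Type*} [Fintype Y] (p q : Y → ℝ) : ℝ :=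
  Real.sqrt (1 - cFid p q)

/-- Non-signaling simulation error of a classical channel with communication size `M`. -/
def cEpsNS {X Y : Type*} [Fintype X] [Fintype Y] (W : X → Y → ℝ) (M : ℝ) : ℝ :=
  sInf { e : ℝ | ∃ (W' : X → Y → ℝ) (q : Y → ℝ), IsChannel W' ∧ IsProbDist q ∧
    (∀ x y, W' x y ≤ M * q y) ∧ e = ⨆ x, cPD (W x) (W' x) }

/-- Shared-randomness simulation error of a classical channel with communication size `M`. -/
def cEpsSR {X Y : Type*} [Fintype X] [Fintype Y] (W : X → Y → ℝ) (M : ℝ) : ℝ :=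
  sInf { e : ℝ | ∃ (k m : ℕ) (pS : Fin k → ℝ) (Enc : X → Fin k → Fin m → ℝ)
    (Dec : Fin m → Fin k → Y → ℝ),
    IsProbDist pS ∧ (∀ x s, IsProbDist (Enc x s)) ∧ (∀ i s, IsProbDist (Dec i s)) ∧
    (m : ℝ) ≤ M ∧
    e = ⨆ x, cPD (W x) (fun y => ∑ s, pS s * ∑ i, Enc x s i * Dec i s y) }

/-- Classical Rényi divergence of order `α > 0`, with values in the extended reals:
the Kullback–Leibler divergence at `α = 1`, and `+∞` whenever `α > 1` (or `α = 1`)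
and the support of `p` is not contained in that of `q`. -/
def cRenyiD {Y : Type*} [Fintype Y] (α : ℝ) (p q : Y → ℝ) : EReal :=
  if α = 1 then
    (if ∀ y, q y = 0 → p y = 0 then
      ((∑ y, p y * Real.log (p y / q y) : ℝ) : EReal) else (⊤ : EReal))
  else if 1 < α ∧ ¬ (∀ y, q y = 0 → p y = 0) then (⊤ : EReal)
  else (((α - 1)⁻¹ * Real.log (∑ y, p y ^ α * q y ^ (1 - α)) : ℝ) : EReal)

/-- Rényi mutual information `I_α(W) = inf_q sup_x D_α(W(·|x)‖q)` of a classical channel. -/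
def cRenyiMI {X Y : Type*} [Fintype X] [Fintype Y] (α : ℝ) (W : X → Y → ℝ) : EReal :=
  ⨅ q : {q : Y → ℝ // IsProbDist q}, ⨆ x, cRenyiD α (W x) q.1

/-- Kullback–Leibler divergence (real-valued formula, valid on matching supports). -/
def cKL {Y : Type*} [Fintype Y] (p q : Y → ℝ) : ℝ :=
  ∑ y, p y * Real.log (p y / q y)

/-- Relative-entropy variance (real-valued formula, valid on matching supports). -/
def cVar {Y : Type*} [Fintype Y] (p q : Y → ℝ) : ℝ :=
  (∑ y, p y * (Real.log (p y / q y)) ^ 2) - (cKL p q) ^ 2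

/-- The empirical type of a word `xs ∈ X^n`. -/
def empType {X : Type*} [Fintype X] {n : ℕ} (xs : Fin n → X) : X → ℝ :=
  fun x => (Finset.univ.filter fun i => xs i = x).card / n

/-! ### Quantum definitions -/

/-- A density matrix: positive semidefinite with unit trace. -/
def IsDensity {n : Type*} [Fintype n] [DecidableEq n] (ρ : Matrix n n ℂ) : Prop :=
  ρ.PosSemidef ∧ ρ.trace = 1

/-- Functional calculus for Hermitian matrices (junk value `0` on non-Hermitian input). -/
def matFun {n : Type*} [Fintype n] [DecidableEq n] (f : ℝ → ℝ) (A : Matrix n n ℂ) :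
    Matrix n n ℂ :=
  if hA : A.IsHermitian then
    (hA.eigenvectorUnitary : Matrix n n ℂ) *
      Matrix.diagonal (fun i => ((f (hA.eigenvalues i)) : ℂ)) *
      (star (hA.eigenvectorUnitary : Matrix n n ℂ))
  else 0

/-- Fidelity of density matrices: `F(ρ,σ) = (Tr √(√ρ σ √ρ))²`. -/
def qFid {n : Type*} [Fintype n] [DecidableEq n] (ρ σ : Matrix n n ℂ) : ℝ :=
  ((matFun Real.sqrt (matFun Real.sqrt ρ * σ * matFun Real.sqrt ρ)).trace).re ^ 2

/-- Purified distance of density matrices. -/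
def qPD {n : Type*} [Fintype n] [DecidableEq n] (ρ σ : Matrix n n ℂ) : ℝ :=
  Real.sqrt (1 - qFid ρ σ)

/-- Non-signaling simulation error of a classical-quantum channel with communication size `M`. -/
def qEpsNS {X B : Type*} [Fintype X] [Fintype B] [DecidableEq B]
    (W : X → Matrix B B ℂ) (M : ℝ) : ℝ :=
  sInf { e : ℝ | ∃ (W' : X → Matrix B B ℂ) (σ : Matrix B B ℂ),
    (∀ x, IsDensity (W' x)) ∧ IsDensity σ ∧ (∀ x, (M • σ - W' x).PosSemidef) ∧
    e = ⨆ x, qPD (W x) (W' x) }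

/-- Support inclusion `supp ρ ⊆ supp σ` for positive semidefinite matrices, expressed
via kernels: every vector killed by `σ` is killed by `ρ`. -/
def suppLE {n : Type*} [Fintype n] (ρ σ : Matrix n n ℂ) : Prop :=
  ∀ v, σ.mulVec v = 0 → ρ.mulVec v = 0

/-- Umegaki relative entropy `D(ρ‖σ) = Tr ρ (log ρ − log σ)` (logarithms on supports;
real-valued formula, valid when `supp ρ ⊆ supp σ`). -/
def relEntQ {n : Type*} [Fintype n] [DecidableEq n] (ρ σ : Matrix n n ℂ) : ℝ :=
  ((ρ * (matFun Real.log ρ - matFun Real.log σ)).trace).re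

/-- Quantum relative-entropy variance `Tr ρ (log ρ − log σ)² − D(ρ‖σ)²`. -/
def varQ {n : Type*} [Fintype n] [DecidableEq n] (ρ σ : Matrix n n ℂ) : ℝ :=
  ((ρ * (matFun Real.log ρ - matFun Real.log σ) ^ 2).trace).re - (relEntQ ρ σ) ^ 2

/-- Sandwiched Rényi divergence of order `α`, valued in the extended reals:
`D̃_α(ρ‖σ) = (α−1)⁻¹ log Tr (σ^{(1−α)/(2α)} ρ σ^{(1−α)/(2α)})^α`, with the Umegaki relative
entropy at `α = 1`, and `+∞` when `α ≥ 1` and `supp ρ ⊄ supp σ`, or `α < 1` and `ρσ = 0`. -/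
def sandD {n : Type*} [Fintype n] [DecidableEq n] (α : ℝ) (ρ σ : Matrix n n ℂ) : EReal :=
  if α = 1 then (if suppLE ρ σ then ((relEntQ ρ σ : ℝ) : EReal) else (⊤ : EReal))
  else if (1 < α ∧ ¬ suppLE ρ σ) ∨ (α < 1 ∧ ρ * σ = 0) then (⊤ : EReal)
  else (((α - 1)⁻¹ * Real.log
      (((matFun (fun t => t ^ α)
        (matFun (fun t => t ^ ((1 - α) / (2 * α))) σ * ρ *
          matFun (fun t => t ^ ((1 - α) / (2 * α))) σ)).trace).re) : ℝ) : EReal)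

/-- Sandwiched Rényi mutual information `Ĩ_α(W) = inf_σ sup_x D̃_α(W_x‖σ)` of a CQ channel. -/
def sandMI {X B : Type*} [Fintype X] [Fintype B] [DecidableEq B]
    (α : ℝ) (W : X → Matrix B B ℂ) : EReal :=
  ⨅ σ : {σ : Matrix B B ℂ // IsDensity σ}, ⨆ x, sandD α (W x) σ.1

/-- `n`-fold tensor power `ρ^{⊗n}` of a matrix, realized on the index set `Fin n → B`. -/
def tensPow {B : Type*} (ρ : Matrix B B ℂ) (n : ℕ) :
    Matrix (Fin n → B) (Fin n → B) ℂ :=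
  Matrix.of fun a b => ∏ i, ρ (a i) (b i)

/-- Tensor product `V_1 ⊗ ⋯ ⊗ V_k` of a family of matrices. -/
def tensProd {B : Type*} {k : ℕ} (V : Fin k → Matrix B B ℂ) :
    Matrix (Fin k → B) (Fin k → B) ℂ :=
  Matrix.of fun a b => ∏ i, V i (a i) (b i)

/-- The `n`-fold product CQ channel `W^{⊗n}`. -/
def cqPow {X B : Type*} (W : X → Matrix B B ℂ) (n : ℕ) :
    (Fin n → X) → Matrix (Fin n → B) (Fin n → B) ℂ :=
  fun xs => Matrix.of fun a b => ∏ i, W (xs i) (a i) (b i)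

/-- Minimal positive eigenvalue of a Hermitian matrix (junk value `0` otherwise). -/
def minPosEig {n : Type*} [Fintype n] [DecidableEq n] (A : Matrix n n ℂ) : ℝ :=
  if hA : A.IsHermitian then sInf {t : ℝ | 0 < t ∧ ∃ i, hA.eigenvalues i = t} else 0

/-- Extended-real exponential, sending `⊥ = −∞` to `0`. -/
def expE (x : EReal) : ℝ := if x = ⊥ then 0 else Real.exp x.toReal


/-- The joint classical–quantum state `W∘p = Σ_x p(x) |x⟩⟨x| ⊗ W_x` as a block-diagonal
matrix on `ℂ^{|X|} ⊗ B`. -/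
def cqJoint {X B : Type*} [DecidableEq X] (p : X → ℝ) (W : X → Matrix B B ℂ) :
    Matrix (X × B) (X × B) ℂ :=
  Matrix.of fun a b => if a.1 = b.1 then (p a.1 : ℂ) * W a.1 a.2 b.2 else 0

end ChannelSim

namespace ChannelSim
open Matrix

theorem matFun_conj {n : Type*} [Fintype n] [DecidableEq n] (f : ℝ → ℝ)
    {U : Matrix n n ℂ} (hU : U * Uᴴ = 1) (l : n → ℝ) :
    matFun f (U * diagonal (fun i => (l i : ℂ)) * Uᴴ) =
      U * diagonal (fun i => (f (l i) : ℂ)) * Uᴴ := by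
  have hU' : Uᴴ * U = 1 := mul_eq_one_comm.mp hU
  have hA : (U * diagonal (fun i => (l i : ℂ)) * Uᴴ).IsHermitian := by
    unfold IsHermitian
    simp only [conjTranspose_mul, diagonal_conjTranspose, conjTranspose_conjTranspose, mul_assoc]
    congr 3
    ext i
    simp
  rw [matFun, dif_pos hA]
  set V : Matrix n n ℂ := (hA.eigenvectorUnitary : Matrix n n ℂ) with hV
  have hV1 : V * star V = 1 := Unitary.coe_mul_star_self _
  have hV2 : star V * V = 1 := Unitary.coe_star_mul_self _
  have hs : U * diagonal (fun i => (l i : ℂ)) * Uᴴ =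
      V * diagonal (fun i => (hA.eigenvalues i : ℂ)) * star V := by
    conv_lhs => rw [hA.spectral_theorem]
    rfl
  set Q : Matrix n n ℂ := star V * U with hQ
  have hq : diagonal (fun i => (hA.eigenvalues i : ℂ)) * Q = Q * diagonal (fun i => (l i : ℂ)) := by
    calc diagonal (fun i => (hA.eigenvalues i : ℂ)) * Q
        = star V * (V * diagonal (fun i => (hA.eigenvalues i : ℂ)) * star V) * U := by
          simp only [hQ, ← mul_assoc, hV2, one_mul]
      _ = Q * diagonal (fun i => (l i : ℂ)) := by
          rw [← hs]
          simp only [hQ, mul_assoc, hU', mul_one]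
  have hq' : diagonal (fun i => (f (hA.eigenvalues i) : ℂ)) * Q =
      Q * diagonal (fun i => (f (l i) : ℂ)) := by
    ext i j
    have h := congrFun (congrFun hq i) j
    simp only [diagonal_mul, mul_diagonal] at h ⊢
    by_cases hz : Q i j = 0
    · simp [hz]
    · rw [mul_comm (Q i j)] at h ⊢
      have := mul_right_cancel₀ hz h
      rw [Complex.ofReal_inj.mp this]
  calc V * diagonal (fun i => (f (hA.eigenvalues i) : ℂ)) * star V
      = V * (diagonal (fun i => (f (hA.eigenvalues i) : ℂ)) * Q) * Uᴴ := by
        simp only [hQ, mul_assoc, hU, mul_one]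
    _ = U * diagonal (fun i => (f (l i) : ℂ)) * Uᴴ := by
        rw [hq', hQ]; simp only [← mul_assoc, hV1, one_mul]

theorem exists_spectral {n : Type*} [Fintype n] [DecidableEq n] {A : Matrix n n ℂ}
    (hA : A.PosSemidef) : ∃ (U : Matrix n n ℂ) (l : n → ℝ), U * Uᴴ = 1 ∧ (∀ i, 0 ≤ l i) ∧
      A = U * diagonal (fun i => (l i : ℂ)) * Uᴴ := by
  refine ⟨hA.1.eigenvectorUnitary, hA.1.eigenvalues, Unitary.coe_mul_star_self _,
    hA.eigenvalues_nonneg, ?_⟩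
  conv_lhs => rw [hA.1.spectral_theorem]
  rfl

open scoped MatrixOrder Matrix.Norms.L2Operator in
theorem matFun_rpow_eq_rpow {n : Type*} [Fintype n] [DecidableEq n] {A : Matrix n n ℂ}
    (hA : A.PosSemidef) (s : ℝ) : matFun (fun t => t ^ s) A = A ^ s := by
  rw [CFC.rpow_eq_cfc_real (nonneg_iff_posSemidef.mpr hA), hA.1.cfc_eq, matFun, dif_pos hA.1]
  rfl

open scoped MatrixOrder Matrix.Norms.L2Operator in
theorem matFun_rpow_mono {n : Type*} [Fintype n] [DecidableEq n] {A B : Matrix n n ℂ}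
    (hA : A.PosSemidef) (hB : B.PosSemidef) (hAB : (B - A).PosSemidef) {s : ℝ} (h0 : 0 ≤ s)
    (h1 : s ≤ 1) :
    (matFun (fun t => t ^ s) B - matFun (fun t => t ^ s) A).PosSemidef := by
  rw [matFun_rpow_eq_rpow hA, matFun_rpow_eq_rpow hB]
  exact le_iff.mp (CFC.rpow_le_rpow ⟨h0, h1⟩ (le_iff.mpr hAB))

theorem matFun_rpow_posSemidef {n : Type*} [Fintype n] [DecidableEq n] {A : Matrix n n ℂ}
    (hA : A.PosSemidef) (s : ℝ) : (matFun (fun t => t ^ s) A).PosSemidef := by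
  obtain ⟨U, l, hU, hl, rfl⟩ := exists_spectral hA
  rw [matFun_conj _ hU]
  exact (PosSemidef.diagonal fun i => by
    simpa using Real.rpow_nonneg (hl i) s).mul_mul_conjTranspose_same U

theorem matFun_sqrt {n : Type*} [Fintype n] [DecidableEq n] (A : Matrix n n ℂ) :
    matFun Real.sqrt A = matFun (fun t => t ^ (1 / 2 : ℝ)) A := by
  congr 1
  funext t
  exact Real.sqrt_eq_rpow t

theorem matFun_rpow_mul_rpow {n : Type*} [Fintype n] [DecidableEq n] {A : Matrix n n ℂ}
    (hA : A.PosSemidef) {s u : ℝ} (hs : 0 ≤ s) (hu : 0 ≤ u) :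
    matFun (fun t => t ^ s) A * matFun (fun t => t ^ u) A = matFun (fun t => t ^ (s + u)) A := by
  obtain ⟨U, l, hU, hl, rfl⟩ := exists_spectral hA
  have hU' : Uᴴ * U = 1 := mul_eq_one_comm.mp hU
  simp only [matFun_conj _ hU]
  calc _ = U * (diagonal (fun i => ((l i ^ s : ℝ) : ℂ)) * (Uᴴ * U) *
        diagonal (fun i => ((l i ^ u : ℝ) : ℂ))) * Uᴴ := by simp only [mul_assoc]
    _ = _ := by
        rw [hU', mul_one, diagonal_mul_diagonal]
        congr 3
        ext i
        rw [Real.rpow_add_of_nonneg (hl i) hs hu, Complex.ofReal_mul]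

theorem matFun_rpow_one {n : Type*} [Fintype n] [DecidableEq n] {A : Matrix n n ℂ}
    (hA : A.PosSemidef) : matFun (fun t => t ^ (1 : ℝ)) A = A := by
  obtain ⟨U, l, hU, hl, rfl⟩ := exists_spectral hA
  simp only [matFun_conj _ hU, Real.rpow_one]

theorem matFun_half_mul_self {n : Type*} [Fintype n] [DecidableEq n] {A : Matrix n n ℂ}
    (hA : A.PosSemidef) :
    matFun (fun t => t ^ (1 / 2 : ℝ)) A * matFun (fun t => t ^ (1 / 2 : ℝ)) A = A := by
  rw [matFun_rpow_mul_rpow hA (by norm_num) (by norm_num), add_halves, matFun_rpow_one hA]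

theorem matFun_sqrt_sq {n : Type*} [Fintype n] [DecidableEq n] {A : Matrix n n ℂ}
    (hA : A.PosSemidef) : matFun Real.sqrt (A * A) = A := by
  obtain ⟨U, l, hU, hl, rfl⟩ := exists_spectral hA
  have hU' : Uᴴ * U = 1 := mul_eq_one_comm.mp hU
  have : U * diagonal (fun i => (l i : ℂ)) * Uᴴ * (U * diagonal (fun i => (l i : ℂ)) * Uᴴ) =
      U * diagonal (fun i => ((l i * l i : ℝ) : ℂ)) * Uᴴ := by
    calc _ = U * (diagonal (fun i => (l i : ℂ)) * (Uᴴ * U) * diagonal (fun i => (l i : ℂ))) * Uᴴ := by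
          simp only [mul_assoc]
      _ = _ := by
          rw [hU', mul_one, diagonal_mul_diagonal]; simp
  rw [this, matFun_conj _ hU]
  simp only [Real.sqrt_mul_self (hl _)]

theorem matFun_smul_rpow {n : Type*} [Fintype n] [DecidableEq n] {A : Matrix n n ℂ}
    (hA : A.PosSemidef) {c : ℝ} (hc : 0 ≤ c) (s : ℝ) :
    matFun (fun t => t ^ s) (c • A) = c ^ s • matFun (fun t => t ^ s) A := by
  obtain ⟨U, l, hU, hl, rfl⟩ := exists_spectral hA
  have : c • (U * diagonal (fun i => (l i : ℂ)) * Uᴴ) =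
      U * diagonal (fun i => ((c * l i : ℝ) : ℂ)) * Uᴴ := by
    rw [← Matrix.smul_mul, ← Matrix.mul_smul, ← diagonal_smul]
    congr 3
    ext i
    simp
  rw [this, matFun_conj _ hU, matFun_conj _ hU, ← Matrix.smul_mul, ← Matrix.mul_smul, ← diagonal_smul]
  congr 3
  ext i
  simp [Real.mul_rpow hc (hl i)]

/-- Trace of the functional calculus through the characteristic polynomial. -/
theorem trace_matFun {n : Type*} [Fintype n] [DecidableEq n] {A : Matrix n n ℂ}
    (hA : A.IsHermitian) (f : ℝ → ℝ) :
    (matFun f A).trace = (A.charpoly.roots.map fun z => (f z.re : ℂ)).sum := by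
  rw [matFun, dif_pos hA, hA.roots_charpoly_eq_eigenvalues, trace_mul_cycle,
    show star (hA.eigenvectorUnitary : Matrix n n ℂ) * hA.eigenvectorUnitary = 1 from
      Unitary.coe_star_mul_self _, one_mul, trace_diagonal]
  simp [Multiset.map_map]

theorem trace_matFun_mul_conjTranspose {n : Type*} [Fintype n] [DecidableEq n]
    (A : Matrix n n ℂ) (f : ℝ → ℝ) :
    (matFun f (A * Aᴴ)).trace = (matFun f (Aᴴ * A)).trace := by
  rw [trace_matFun (isHermitian_mul_conjTranspose_self A),
    trace_matFun (isHermitian_conjTranspose_mul_self A), charpoly_mul_comm]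

theorem trace_re_mono {n : Type*} [Fintype n] {A B : Matrix n n ℂ}
    (hAB : (B - A).PosSemidef) : A.trace.re ≤ B.trace.re := by
  have h := hAB.trace_nonneg
  rw [trace_sub] at h
  have := (Complex.le_def.mp h).1
  simp at this
  linarith

/-- The trace functional inside the sandwiched Rényi divergence of order `α`. -/
def sandQ {n : Type*} [Fintype n] [DecidableEq n] (α : ℝ) (ρ σ : Matrix n n ℂ) : ℝ :=
  ((matFun (fun t => t ^ α)
    (matFun (fun t => t ^ ((1 - α) / (2 * α))) σ * ρ *
      matFun (fun t => t ^ ((1 - α) / (2 * α))) σ)).trace).re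

theorem posSemidef_real_smul {n : Type*} {A : Matrix n n ℂ} (hA : A.PosSemidef)
    {c : ℝ} (hc : 0 ≤ c) : (c • A).PosSemidef := by
  have : c • A = (c : ℂ) • A := by ext; simp
  rw [this]
  exact hA.smul (by exact_mod_cast hc)

theorem posSemidef_mul_mul_self {n : Type*} [Fintype n] {A P : Matrix n n ℂ}
    (hA : A.PosSemidef) (hP : P.PosSemidef) :
    (P * A * P).PosSemidef := by
  have := hA.mul_mul_conjTranspose_same P
  rwa [hP.1] at this

section
variable {n : Type*} [Fintype n] [DecidableEq n]

/-- Peierls' inequality for the concave functions `t ↦ t ^ α`. -/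
theorem trace_rpow_le_sum_diag {X U : Matrix n n ℂ} (hX : X.PosSemidef) (hU : U * Uᴴ = 1)
    {α : ℝ} (h0 : 0 ≤ α) (h1 : α ≤ 1) :
    (matFun (fun t => t ^ α) X).trace.re ≤ ∑ y, ((Uᴴ * X * U) y y).re ^ α := by
  obtain ⟨V, l, hV, hl, rfl⟩ := exists_spectral hX
  have hU' : Uᴴ * U = 1 := mul_eq_one_comm.mp hU
  have hV' : Vᴴ * V = 1 := mul_eq_one_comm.mp hV
  rw [matFun_conj _ hV]
  set R : Matrix n n ℂ := Uᴴ * V with hR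
  have hRR : R * Rᴴ = 1 := by
    rw [hR, conjTranspose_mul, conjTranspose_conjTranspose]
    calc Uᴴ * V * (Vᴴ * U) = Uᴴ * (V * Vᴴ) * U := by simp only [mul_assoc]
      _ = 1 := by rw [hV, mul_one, hU']
  have hRR' : Rᴴ * R = 1 := mul_eq_one_comm.mp hRR
  have hrow : ∀ y, ∑ i, Complex.normSq (R y i) = 1 := by
    intro y
    have := congrArg Complex.re (congrFun (congrFun hRR y) y)
    simpa [mul_apply, conjTranspose_apply, Complex.mul_conj, Complex.ofReal_re] using this
  have hcol : ∀ i, ∑ y, Complex.normSq (R y i) = 1 := by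
    intro i
    have := congrArg Complex.re (congrFun (congrFun hRR' i) i)
    simpa [mul_apply, conjTranspose_apply, Complex.normSq_eq_conj_mul_self.symm,
      Complex.ofReal_re] using this
  have hdiag : ∀ y, ((Uᴴ * (V * diagonal (fun i => (l i : ℂ)) * Vᴴ) * U) y y).re =
      ∑ i, Complex.normSq (R y i) * l i := by
    intro y
    have : Uᴴ * (V * diagonal (fun i => (l i : ℂ)) * Vᴴ) * U =
        R * diagonal (fun i => (l i : ℂ)) * Rᴴ := by
      rw [hR, conjTranspose_mul, conjTranspose_conjTranspose]
      simp only [mul_assoc]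
    rw [this, mul_apply, Complex.re_sum]
    refine Finset.sum_congr rfl fun i _ => ?_
    rw [mul_diagonal, conjTranspose_apply, mul_right_comm, Complex.star_def, Complex.mul_conj,
      ← Complex.ofReal_mul, Complex.ofReal_re]
  have htr : (V * diagonal (fun i => ((l i ^ α : ℝ) : ℂ)) * Vᴴ).trace.re = ∑ i, l i ^ α := by
    rw [trace_mul_cycle, hV', one_mul, trace_diagonal]
    simp
  rw [htr]
  calc ∑ i, l i ^ α = ∑ i, (∑ y, Complex.normSq (R y i)) * l i ^ α := by simp [hcol]
    _ = ∑ y, ∑ i, Complex.normSq (R y i) * l i ^ α := by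
        simp_rw [Finset.sum_mul]; exact Finset.sum_comm
    _ ≤ ∑ y, (∑ i, Complex.normSq (R y i) * l i) ^ α := by
        refine Finset.sum_le_sum fun y _ => ?_
        have := (Real.concaveOn_rpow h0 h1).le_map_sum (t := Finset.univ)
          (w := fun i => Complex.normSq (R y i)) (p := l)
          (fun i _ => Complex.normSq_nonneg _) (hrow y) (fun i _ => hl i)
        simpa using this
    _ = _ := by simp_rw [hdiag]

theorem sandQ_eq {α : ℝ} (hα : 0 < α) (hα1 : α ≤ 1) {ρ σ : Matrix n n ℂ}
    (hρ : ρ.PosSemidef) (hσ : σ.PosSemidef) :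
    sandQ α ρ σ = ((matFun (fun t => t ^ α) (matFun (fun t => t ^ (1 / 2 : ℝ)) ρ *
      matFun (fun t => t ^ ((1 - α) / α)) σ * matFun (fun t => t ^ (1 / 2 : ℝ)) ρ)).trace).re := by
  set s := (1 - α) / (2 * α) with hs
  have hs0 : 0 ≤ s := div_nonneg (by linarith) (by linarith)
  have hss : (1 - α) / α = s + s := by rw [hs]; field_simp; ring
  set S := matFun (fun t => t ^ s) σ with hS
  set P := matFun (fun t => t ^ (1 / 2 : ℝ)) ρ with hP
  have hSS : matFun (fun t => t ^ ((1 - α) / α)) σ = S * S := by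
    rw [hss, matFun_rpow_mul_rpow hσ hs0 hs0]
  have hPP : ρ = P * P := (matFun_half_mul_self hρ).symm
  have hSh : Sᴴ = S := (matFun_rpow_posSemidef hσ s).1
  have hPh : Pᴴ = P := (matFun_rpow_posSemidef hρ _).1
  have h1 : S * ρ * S = (S * P) * (S * P)ᴴ := by
    rw [conjTranspose_mul, hSh, hPh]
    conv_lhs => rw [hPP]
    simp only [mul_assoc]
  have h2 : P * (S * S) * P = (S * P)ᴴ * (S * P) := by
    rw [conjTranspose_mul, hSh, hPh]
    simp only [mul_assoc]
  rw [sandQ, ← hs, ← hS, h1, trace_matFun_mul_conjTranspose, hSS, h2]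

theorem sandQ_mono {α : ℝ} (hα : 1 / 2 ≤ α) (hα1 : α ≤ 1) {ρ σ τ : Matrix n n ℂ}
    (hρ : ρ.PosSemidef) (hσ : σ.PosSemidef) (hτ : τ.PosSemidef) {c : ℝ} (hc : 0 ≤ c)
    (h : (τ - c • σ).PosSemidef) :
    c ^ (1 - α) * sandQ α ρ σ ≤ sandQ α ρ τ := by
  have hα0 : 0 < α := by linarith
  have ht0 : 0 ≤ (1 - α) / α := div_nonneg (by linarith) hα0.le
  have ht1 : (1 - α) / α ≤ 1 := by rw [div_le_one hα0]; linarith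
  rw [sandQ_eq hα0 hα1 hρ hσ, sandQ_eq hα0 hα1 hρ hτ]
  set P := matFun (fun t => t ^ (1 / 2 : ℝ)) ρ with hP
  have hPp : P.PosSemidef := matFun_rpow_posSemidef hρ _
  have hmono := matFun_rpow_mono (posSemidef_real_smul hσ hc) hτ h ht0 ht1
  rw [matFun_smul_rpow hσ hc] at hmono
  set S := matFun (fun t => t ^ ((1 - α) / α)) σ with hS
  set T := matFun (fun t => t ^ ((1 - α) / α)) τ with hT
  have hSp : S.PosSemidef := matFun_rpow_posSemidef hσ _
  have hTp : T.PosSemidef := matFun_rpow_posSemidef hτ _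
  have hc' : 0 ≤ c ^ ((1 - α) / α) := Real.rpow_nonneg hc _
  have h3 : (P * T * P - c ^ ((1 - α) / α) • (P * S * P)).PosSemidef := by
    have := posSemidef_mul_mul_self hmono hPp
    rwa [mul_sub, sub_mul, Matrix.mul_smul, Matrix.smul_mul] at this
  have hPSP := posSemidef_mul_mul_self hSp hPp
  have hPTP := posSemidef_mul_mul_self hTp hPp
  have h4 := trace_re_mono
    (matFun_rpow_mono (posSemidef_real_smul hPSP hc') hPTP h3 hα0.le hα1)
  rw [matFun_smul_rpow hPSP hc', trace_smul, Complex.smul_re, ← Real.rpow_mul hc,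
    div_mul_cancel₀ _ hα0.ne'] at h4
  simpa using h4

theorem trace_matFun_rpow_nonneg {A : Matrix n n ℂ} (hA : A.PosSemidef) (s : ℝ) :
    0 ≤ (matFun (fun t => t ^ s) A).trace.re :=
  (Complex.le_def.mp (matFun_rpow_posSemidef hA s).trace_nonneg).1

theorem sandwich_posSemidef {ρ σ : Matrix n n ℂ} (hρ : ρ.PosSemidef) (hσ : σ.PosSemidef) (s : ℝ) :
    (matFun (fun t => t ^ s) σ * ρ * matFun (fun t => t ^ s) σ).PosSemidef :=
  posSemidef_mul_mul_self hρ (matFun_rpow_posSemidef hσ s)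

theorem sandQ_nonneg (α : ℝ) {ρ σ : Matrix n n ℂ} (hρ : ρ.PosSemidef) (hσ : σ.PosSemidef) :
    0 ≤ sandQ α ρ σ :=
  trace_matFun_rpow_nonneg (sandwich_posSemidef hρ hσ _) α

theorem eq_zero_of_trace_rpow {A : Matrix n n ℂ} (hA : A.PosSemidef) {α : ℝ} (hα : 0 < α)
    (h : (matFun (fun t => t ^ α) A).trace.re = 0) : A = 0 := by
  obtain ⟨V, l, hV, hl, rfl⟩ := exists_spectral hA
  have hV' : Vᴴ * V = 1 := mul_eq_one_comm.mp hV
  rw [matFun_conj _ hV, trace_mul_cycle, hV', one_mul, trace_diagonal] at h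
  have h' : ∑ i, l i ^ α = 0 := by simpa using h
  rw [Finset.sum_eq_zero_iff_of_nonneg fun i _ => Real.rpow_nonneg (hl i) α] at h'
  have : (fun i => (l i : ℂ)) = 0 := by
    funext i
    have := (Real.rpow_eq_zero (hl i) hα.ne').mp (h' i (Finset.mem_univ i))
    simp [this]
  rw [this]
  simp

theorem sandQ_pos {α : ℝ} (hα : 1 / 2 ≤ α) (hα1 : α ≤ 1) {ρ σ : Matrix n n ℂ}
    (hρ : ρ.PosSemidef) (hσ : σ.PosSemidef) (h : ρ * σ ≠ 0) : 0 < sandQ α ρ σ := by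
  refine lt_of_le_of_ne (sandQ_nonneg α hρ hσ) fun h0 => h ?_
  have hα0 : 0 < α := by linarith
  set s := (1 - α) / (2 * α) with hs
  have hs0 : 0 ≤ s := div_nonneg (by linarith) (by linarith)
  have hs1 : s ≤ 1 := by rw [hs, div_le_one (by linarith)]; linarith
  have hz := eq_zero_of_trace_rpow (sandwich_posSemidef hρ hσ s) hα0 h0.symm
  set S := matFun (fun t => t ^ s) σ with hS
  set P := matFun (fun t => t ^ (1 / 2 : ℝ)) ρ with hP
  have hSh : Sᴴ = S := (matFun_rpow_posSemidef hσ s).1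
  have hPh : Pᴴ = P := (matFun_rpow_posSemidef hρ _).1
  have hPP : ρ = P * P := (matFun_half_mul_self hρ).symm
  have h1 : (P * S)ᴴ * (P * S) = 0 := by
    rw [conjTranspose_mul, hSh, hPh, ← hz]
    conv_rhs => rw [hPP]
    simp only [mul_assoc]
  have h2 : P * S = 0 := conjTranspose_mul_self_eq_zero.mp h1
  have h3 : σ = S * matFun (fun t => t ^ (1 - s)) σ := by
    rw [hS, matFun_rpow_mul_rpow hσ hs0 (by linarith)]
    simpa using (matFun_rpow_one hσ).symm
  rw [h3, hPP]
  calc P * P * (S * matFun (fun t => t ^ (1 - s)) σ) =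
      P * (P * S) * matFun (fun t => t ^ (1 - s)) σ := by simp only [mul_assoc]
    _ = 0 := by rw [h2]; simp

theorem trace_rpow_one_matrix (s : ℝ) : matFun (fun t => t ^ s) (1 : Matrix n n ℂ) = 1 := by
  have := matFun_conj (n := n) (fun t => t ^ s) (U := 1) (by simp) (fun _ => 1)
  simpa [Matrix.diagonal_one] using this

theorem IsDensity.eigen_le_one {ρ U : Matrix n n ℂ} (h : IsDensity ρ) (hU : U * Uᴴ = 1)
    {l : n → ℝ} (hl : ∀ i, 0 ≤ l i) (hρ : ρ = U * diagonal (fun i => (l i : ℂ)) * Uᴴ) :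
    ∑ i, l i = 1 ∧ ∀ i, l i ≤ 1 := by
  have hU' : Uᴴ * U = 1 := mul_eq_one_comm.mp hU
  have h1 := h.2
  rw [hρ, trace_mul_cycle, hU', one_mul, trace_diagonal] at h1
  have h2 : ∑ i, l i = 1 := by exact_mod_cast h1
  refine ⟨h2, fun i => ?_⟩
  rw [← h2]
  exact Finset.single_le_sum (fun i _ => hl i) (Finset.mem_univ i)

theorem IsDensity.le_one {ρ : Matrix n n ℂ} (h : IsDensity ρ) : (1 - ρ).PosSemidef := by
  obtain ⟨U, l, hU, hl, hρ⟩ := exists_spectral h.1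
  have hle := (h.eigen_le_one hU hl hρ).2
  have : (1 : Matrix n n ℂ) - ρ = U * diagonal (fun i => ((1 - l i : ℝ) : ℂ)) * Uᴴ := by
    have hd : diagonal (fun i => ((1 - l i : ℝ) : ℂ)) = 1 - diagonal (fun i => (l i : ℂ)) := by
      rw [← diagonal_one, diagonal_sub]; simp
    rw [hd, mul_sub, sub_mul, mul_one, hU, ← hρ]
  rw [this]
  refine (PosSemidef.diagonal fun i => ?_).mul_mul_conjTranspose_same U
  show (0 : ℂ) ≤ ((1 - l i : ℝ) : ℂ)
  exact_mod_cast sub_nonneg.mpr (hle i)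

theorem one_le_trace_rpow {ρ : Matrix n n ℂ} (h : IsDensity ρ) {s : ℝ} (hs : 0 ≤ s) (h1 : s ≤ 1) :
    1 ≤ (matFun (fun t => t ^ s) ρ).trace.re := by
  obtain ⟨U, l, hU, hl, hρ⟩ := exists_spectral h.1
  obtain ⟨hsum, hle⟩ := h.eigen_le_one hU hl hρ
  have hU' : Uᴴ * U = 1 := mul_eq_one_comm.mp hU
  rw [hρ, matFun_conj _ hU, trace_mul_cycle, hU', one_mul, trace_diagonal]
  simp only [Complex.re_sum, Complex.ofReal_re]
  rw [← hsum]
  refine Finset.sum_le_sum fun i _ => ?_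
  conv_lhs => rw [← Real.rpow_one (l i)]
  rcases (hl i).eq_or_lt with h0 | h0
  · rcases hs.eq_or_lt with h2 | h2
    · rw [← h0, ← h2]; simp
    · rw [← h0, Real.zero_rpow h2.ne']; simp
  · exact Real.rpow_le_rpow_of_exponent_ge h0 (hle i) h1

theorem trace_rpow_le_card {ρ : Matrix n n ℂ} (h : IsDensity ρ) {s : ℝ} (hs : 0 ≤ s) :
    (matFun (fun t => t ^ s) ρ).trace.re ≤ Fintype.card n := by
  obtain ⟨U, l, hU, hl, hρ⟩ := exists_spectral h.1
  obtain ⟨hsum, hle⟩ := h.eigen_le_one hU hl hρ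
  have hU' : Uᴴ * U = 1 := mul_eq_one_comm.mp hU
  rw [hρ, matFun_conj _ hU, trace_mul_cycle, hU', one_mul, trace_diagonal]
  simp only [Complex.re_sum, Complex.ofReal_re]
  calc ∑ i, l i ^ s ≤ ∑ i : n, (1 : ℝ) :=
        Finset.sum_le_sum fun i _ => Real.rpow_le_one (hl i) (hle i) hs
    _ = _ := by simp

theorem sandQ_one_right {α : ℝ} {ρ : Matrix n n ℂ} :
    sandQ α ρ 1 = (matFun (fun t => t ^ α) ρ).trace.re := by
  rw [sandQ, trace_rpow_one_matrix, one_mul, mul_one]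

theorem sandQ_le_card {α : ℝ} (hα : 1 / 2 ≤ α) (hα1 : α ≤ 1) {ρ σ : Matrix n n ℂ}
    (hρ : IsDensity ρ) (hσ : IsDensity σ) : sandQ α ρ σ ≤ Fintype.card n := by
  have := sandQ_mono (c := 1) hα hα1 hρ.1 hσ.1 PosSemidef.one zero_le_one
    (by rw [one_smul]; exact hσ.le_one)
  rw [Real.one_rpow, one_mul, sandQ_one_right] at this
  exact this.trans (trace_rpow_le_card hρ (by linarith))

end

/-- Tensor product of a family of matrices, with row and column indices read through `e`. -/
def tens {ι I : Type*} {C : ι → Type*} [Fintype ι] (e : I → ∀ b, C b)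
    (A : ∀ b, Matrix (C b) (C b) ℂ) : Matrix I I ℂ :=
  Matrix.of fun x y => ∏ b, A b (e x b) (e y b)

theorem sum_prod_comp {ι I R : Type*} {C : ι → Type*} [Fintype ι] [Fintype I]
    [∀ b, Fintype (C b)] [CommSemiring R] {e : I → ∀ b, C b} (he : Function.Bijective e)
    (g : ∀ b, C b → R) : ∑ x, ∏ b, g b (e x b) = ∏ b, ∑ c, g b c := by
  rw [Finset.prod_univ_sum, Fintype.piFinset_univ]
  exact he.sum_comp (fun z => ∏ b, g b (z b))

section
variable {ι I : Type*} {C : ι → Type*} [Fintype ι] [Fintype I] [DecidableEq I]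
  [∀ b, Fintype (C b)] [∀ b, DecidableEq (C b)] {e : I → ∀ b, C b}

theorem tens_mul (he : Function.Bijective e) (A B : ∀ b, Matrix (C b) (C b) ℂ) :
    tens e A * tens e B = tens e fun b => A b * B b := by
  ext x y
  simp only [tens, mul_apply, of_apply, ← Finset.prod_mul_distrib]
  exact sum_prod_comp he fun b c => A b (e x b) c * B b c (e y b)

theorem tens_diagonal (he : Function.Bijective e) (l : ∀ b, C b → ℂ) :
    tens e (fun b => diagonal (l b)) = diagonal fun x => ∏ b, l b (e x b) := by
  ext x y
  simp only [tens, of_apply, diagonal_apply]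
  split_ifs with h
  · subst h; simp
  · have : ∃ b, e x b ≠ e y b := by
      by_contra hc
      push Not at hc
      exact h (he.1 (funext hc))
    obtain ⟨b, hb⟩ := this
    exact Finset.prod_eq_zero (Finset.mem_univ b) (by rw [if_neg hb])

theorem tens_one (he : Function.Bijective e) :
    tens e (fun b => (1 : Matrix (C b) (C b) ℂ)) = 1 := by
  simp only [← diagonal_one]
  rw [tens_diagonal he]
  simp

theorem tens_conjTranspose (A : ∀ b, Matrix (C b) (C b) ℂ) :
    (tens e A)ᴴ = tens e fun b => (A b)ᴴ := by
  ext x y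
  simp [tens, conjTranspose_apply]

theorem tens_trace (he : Function.Bijective e) (A : ∀ b, Matrix (C b) (C b) ℂ) :
    (tens e A).trace = ∏ b, (A b).trace := by
  simp only [trace, tens, diag_apply, of_apply]
  exact sum_prod_comp he fun b c => A b c c

theorem tens_unitary (he : Function.Bijective e) {U : ∀ b, Matrix (C b) (C b) ℂ}
    (hU : ∀ b, U b * (U b)ᴴ = 1) : tens e U * (tens e U)ᴴ = 1 := by
  rw [tens_conjTranspose, tens_mul he]
  simp only [hU, tens_one he]

theorem tens_conj_diagonal_aux (he : Function.Bijective e) (U D : ∀ b, Matrix (C b) (C b) ℂ) :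
    (tens e fun b => U b * D b * (U b)ᴴ) = tens e U * tens e D * (tens e U)ᴴ := by
  rw [tens_conjTranspose, tens_mul he, tens_mul he]

theorem tens_conj_diagonal (he : Function.Bijective e) (U : ∀ b, Matrix (C b) (C b) ℂ)
    (l : ∀ b, C b → ℝ) :
    (tens e fun b => U b * diagonal (fun c => (l b c : ℂ)) * (U b)ᴴ) =
      tens e U * diagonal (fun x => ((∏ b, l b (e x b) : ℝ) : ℂ)) * (tens e U)ᴴ := by
  rw [tens_conj_diagonal_aux he, tens_diagonal he]
  simp only [Complex.ofReal_prod]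

theorem tens_posSemidef (he : Function.Bijective e) {A : ∀ b, Matrix (C b) (C b) ℂ}
    (hA : ∀ b, (A b).PosSemidef) : (tens e A).PosSemidef := by
  choose U l hU hl hAe using fun b => exists_spectral (hA b)
  rw [show A = fun b => U b * diagonal (fun c => (l b c : ℂ)) * (U b)ᴴ from funext hAe,
    tens_conj_diagonal he]
  refine (PosSemidef.diagonal fun x => ?_).mul_mul_conjTranspose_same _
  show (0 : ℂ) ≤ ((∏ b, l b (e x b) : ℝ) : ℂ)
  exact_mod_cast Finset.prod_nonneg fun b _ => hl b _

theorem tens_isDensity (he : Function.Bijective e) {A : ∀ b, Matrix (C b) (C b) ℂ}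
    (hA : ∀ b, IsDensity (A b)) : IsDensity (tens e A) :=
  ⟨tens_posSemidef he fun b => (hA b).1, by rw [tens_trace he]; simp [(hA _).2]⟩

theorem tens_matFun_rpow (he : Function.Bijective e) {A : ∀ b, Matrix (C b) (C b) ℂ}
    (hA : ∀ b, (A b).PosSemidef) (s : ℝ) :
    matFun (fun t => t ^ s) (tens e A) = tens e fun b => matFun (fun t => t ^ s) (A b) := by
  choose U l hU hl hAe using fun b => exists_spectral (hA b)
  have h1 : A = fun b => U b * diagonal (fun c => (l b c : ℂ)) * (U b)ᴴ := funext hAe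
  have h2 : (fun b => matFun (fun t => t ^ s) (A b)) =
      fun b => U b * diagonal (fun c => ((l b c ^ s : ℝ) : ℂ)) * (U b)ᴴ := by
    funext b
    rw [hAe b, matFun_conj _ (hU b)]
  rw [h2, h1, tens_conj_diagonal he, tens_conj_diagonal he, matFun_conj _ (tens_unitary he hU)]
  congr 4
  funext x
  rw [Real.finsetProd_rpow _ _ fun b _ => hl b _]

theorem sandQ_tens (he : Function.Bijective e) {ρ σ : ∀ b, Matrix (C b) (C b) ℂ}
    (hρ : ∀ b, (ρ b).PosSemidef) (hσ : ∀ b, (σ b).PosSemidef) (α : ℝ) :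
    sandQ α (tens e ρ) (tens e σ) = ∏ b, sandQ α (ρ b) (σ b) := by
  have h : ∀ b, (sandQ α (ρ b) (σ b) : ℂ) = (matFun (fun t => t ^ α)
      (matFun (fun t => t ^ ((1 - α) / (2 * α))) (σ b) * ρ b *
        matFun (fun t => t ^ ((1 - α) / (2 * α))) (σ b))).trace := fun b => by
    have := (matFun_rpow_posSemidef (sandwich_posSemidef (hρ b) (hσ b)
      ((1 - α) / (2 * α))) α).trace_nonneg
    exact (Complex.eq_re_of_ofReal_le (r := 0) (by exact_mod_cast this)).symm
  rw [sandQ, tens_matFun_rpow he hσ, tens_mul he, tens_mul he,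
    tens_matFun_rpow he fun b => sandwich_posSemidef (hρ b) (hσ b) _, tens_trace he]
  simp only [← h]
  rw [← Complex.ofReal_prod, Complex.ofReal_re]

theorem tens_mono (he : Function.Bijective e) {A B : ∀ b, Matrix (C b) (C b) ℂ}
    (hA : ∀ b, (A b).PosSemidef) (hB : ∀ b, (B b).PosSemidef)
    (hAB : ∀ b, (B b - A b).PosSemidef) : (tens e B - tens e A).PosSemidef := by
  have key : ∀ s : Finset ι,
      (tens e (fun b => if b ∈ s then B b else A b) - tens e A).PosSemidef := by
    intro s
    induction s using Finset.induction_on with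
    | empty => simpa using PosSemidef.zero
    | insert a s ha ih =>
      have h1 : tens e (fun b => if b ∈ insert a s then B b else A b) -
          tens e (fun b => if b ∈ s then B b else A b) =
          tens e (fun b => if b = a then B b - A b else if b ∈ s then B b else A b) := by
        ext x y
        simp only [tens, Matrix.sub_apply, of_apply]
        rw [← Finset.mul_prod_erase _ _ (Finset.mem_univ a),
          ← Finset.mul_prod_erase Finset.univ (fun b => (if b ∈ s then B b else A b) (e x b) (e y b))
            (Finset.mem_univ a),
          ← Finset.mul_prod_erase Finset.univ (fun b => (if b = a then B b - A b else
            if b ∈ s then B b else A b) (e x b) (e y b)) (Finset.mem_univ a)]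
        have e1 : ∏ b ∈ Finset.univ.erase a, (if b ∈ insert a s then B b else A b) (e x b) (e y b) =
            ∏ b ∈ Finset.univ.erase a, (if b ∈ s then B b else A b) (e x b) (e y b) :=
          Finset.prod_congr rfl fun b hb => by simp [Finset.ne_of_mem_erase hb]
        have e2 : ∏ b ∈ Finset.univ.erase a, (if b = a then B b - A b else
            if b ∈ s then B b else A b) (e x b) (e y b) =
            ∏ b ∈ Finset.univ.erase a, (if b ∈ s then B b else A b) (e x b) (e y b) :=
          Finset.prod_congr rfl fun b hb => by simp [Finset.ne_of_mem_erase hb]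
        rw [e1, e2]
        simp [ha, sub_mul]
      have h2 := tens_posSemidef he
        (A := fun b => if b = a then B b - A b else if b ∈ s then B b else A b) fun b => by
          split_ifs
          exacts [hAB b, hB b, hA b]
      rw [← h1] at h2
      simpa using h2.add ih
  simpa using key Finset.univ

end

section
variable {n : Type*} [Fintype n] [DecidableEq n]

/-- Pinching inequality, for a matrix which is already diagonal inside every level set of `N`. -/
theorem pinching_le {v : ℕ} (N : n → Fin v) {R : Matrix n n ℂ} (hR : R.PosSemidef)
    (h : ∀ y z, y ≠ z → N y = N z → R y z = 0) :
    ((v : ℝ) • diagonal (fun y => ((R y y).re : ℂ)) - R).PosSemidef := by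
  let D : Fin v → Fin v → n → ℂ := fun c c' y => (if N y = c then 1 else 0) - if N y = c' then 1 else 0
  have hD : (v : ℝ) • diagonal (fun y => ((R y y).re : ℂ)) - R =
      (1 / 2 : ℝ) • ∑ c, ∑ c', diagonal (D c c') * R * (diagonal (D c c'))ᴴ := by
    ext y z
    have hyz : ∑ c, ∑ c', D c c' y * star (D c c' z) =
        2 * ((if N y = N z then (v : ℂ) else 0) - 1) := by
      have hs : ∀ c c' : Fin v, D c c' y * star (D c c' z) =
          (if N y = c then (if N z = c then 1 else 0) else 0) -
          (if N y = c then 1 else 0) * (if N z = c' then 1 else 0) -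
          (if N y = c' then 1 else 0) * (if N z = c then 1 else 0) +
          (if N y = c' then (if N z = c' then 1 else 0) else 0) := by
        intro c c'
        simp only [D]
        split_ifs <;> simp
      simp only [hs, Finset.sum_add_distrib, Finset.sum_sub_distrib, Finset.sum_ite_eq,
        Finset.mem_univ, if_true, Finset.sum_const, Finset.card_univ, Fintype.card_fin,
        ← Finset.mul_sum, ← Finset.sum_mul, nsmul_eq_mul, eq_comm (a := N z) (b := N y)]
      split_ifs <;> simp <;> ring
    have hdy : (((R y y).re : ℝ) : ℂ) = R y y := hR.1.coe_re_apply_self y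
    simp only [Matrix.sub_apply, Matrix.smul_apply, Matrix.sum_apply, diagonal_conjTranspose, mul_diagonal,
      diagonal_mul, Pi.star_apply]
    have : ∑ c, ∑ c', D c c' y * R y z * star (D c c' z) =
        (∑ c, ∑ c', D c c' y * star (D c c' z)) * R y z := by
      simp_rw [Finset.sum_mul]
      exact Finset.sum_congr rfl fun c _ => Finset.sum_congr rfl fun c' _ => by ring
    rw [this, hyz]
    by_cases he : y = z
    · subst he
      simp only [diagonal_apply_eq, hdy, if_true, Complex.real_smul]
      push_cast
      ring
    · rw [diagonal_apply_ne _ he]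
      by_cases hN : N y = N z
      · simp [h y z he hN]
      · simp only [if_neg hN, Complex.real_smul]
        push_cast
        ring
  rw [hD]
  refine posSemidef_real_smul ?_ (by norm_num)
  exact posSemidef_sum _ fun c _ => posSemidef_sum _ fun c' _ => hR.mul_mul_conjTranspose_same _

/-- Diagonalization of a Hermitian matrix inside every level set of `N`, by a unitary matrix
which respects the level sets. -/
theorem exists_blockwise_diagonalization {ι : Type*} [Fintype ι] [DecidableEq ι] (N : n → ι)
    {R : Matrix n n ℂ} (hR : R.IsHermitian) :
    ∃ U : Matrix n n ℂ, U * Uᴴ = 1 ∧ (∀ y z, N y ≠ N z → U y z = 0) ∧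
      ∀ y z, y ≠ z → N y = N z → (Uᴴ * R * U) y z = 0 := by
  have hH : ∀ c, (R.submatrix (Subtype.val : {y // N y = c} → n) Subtype.val).IsHermitian :=
    fun c => hR.submatrix _
  let E := Equiv.sigmaFiberEquiv N
  let V : ∀ c, Matrix {y // N y = c} {y // N y = c} ℂ := fun c => (hH c).eigenvectorUnitary
  have hV : ∀ c, V c * (V c)ᴴ = 1 := fun c => Unitary.coe_mul_star_self _
  have hVd : ∀ c, (V c)ᴴ * R.submatrix (Subtype.val : {y // N y = c} → n) Subtype.val * V c =
      diagonal fun i => ((hH c).eigenvalues i : ℂ) := by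
    intro c
    have h := (hH c).spectral_theorem
    have h2 : (V c)ᴴ * V c = 1 := Unitary.coe_star_mul_self _
    have h3 : R.submatrix (Subtype.val : {y // N y = c} → n) Subtype.val =
      V c * diagonal (fun i => ((hH c).eigenvalues i : ℂ)) * (V c)ᴴ := h
    refine (congrArg (fun M => (V c)ᴴ * M * V c) h3).trans ?_
    calc (V c)ᴴ * (V c * diagonal (fun i => ((hH c).eigenvalues i : ℂ)) * (V c)ᴴ) * V c
        = ((V c)ᴴ * V c) * diagonal (fun i => ((hH c).eigenvalues i : ℂ)) * ((V c)ᴴ * V c) := by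
          simp only [mul_assoc]
      _ = _ := by rw [h2, one_mul, mul_one]
  let U : Matrix n n ℂ := (blockDiagonal' V).submatrix E.symm E.symm
  have hU0 : ∀ y z, N y ≠ N z → U y z = 0 := by
    intro y z hyz
    simp only [U, submatrix_apply]
    exact blockDiagonal'_apply_ne V _ _ hyz
  have hUe : ∀ (c : ι) (y z : {y // N y = c}), U y z = V c y z := by
    intro c y z
    have h1 : E.symm y.1 = ⟨c, y⟩ := by rw [Equiv.symm_apply_eq]; rfl
    have h2 : E.symm z.1 = ⟨c, z⟩ := by rw [Equiv.symm_apply_eq]; rfl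
    simp only [U, submatrix_apply, h1, h2, blockDiagonal'_apply_eq]
  refine ⟨U, ?_, hU0, ?_⟩
  · simp only [U, conjTranspose_submatrix, submatrix_mul_equiv, blockDiagonal'_conjTranspose,
      ← blockDiagonal'_mul, hV]
    have : (fun k => (1 : Matrix {y // N y = k} {y // N y = k} ℂ)) = 1 := rfl
    rw [this, blockDiagonal'_one, submatrix_one_equiv]
  · intro y z hyz hN
    have hsum : ∀ (g : n → ℂ) (c : ι), (∀ w, N w ≠ c → g w = 0) →
        ∑ w, g w = ∑ w : {w // N w = c}, g w := by
      intro g c hg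
      rw [← Finset.sum_subtype (Finset.univ.filter fun w => N w = c) (by simp) g,
        Finset.sum_filter]
      refine Finset.sum_congr rfl fun w _ => ?_
      split_ifs with h
      · rfl
      · exact hg w h
    have h := congrFun (congrFun (hVd (N z)) ⟨y, hN⟩) ⟨z, rfl⟩
    rw [diagonal_apply_ne _ (by simpa [Subtype.ext_iff] using hyz)] at h
    rw [← h]
    simp only [mul_apply, conjTranspose_apply]
    rw [hsum _ (N z) fun w hw => by rw [hU0 w z hw, mul_zero]]
    refine Finset.sum_congr rfl fun w _ => ?_
    rw [hsum _ (N z) fun x hx => by rw [hU0 x y (by rw [hN]; exact hx)]; simp]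
    rw [← hUe (N z) w ⟨z, rfl⟩]
    congr 1
    refine Finset.sum_congr rfl fun x _ => ?_
    rw [← hUe (N z) x ⟨y, hN⟩]
    rfl

end

section
variable {n : Type*} [Fintype n] [DecidableEq n]

theorem conj_diagonal_sub {U : Matrix n n ℂ} (a b : n → ℝ) (c : ℝ) :
    U * diagonal (fun i => (a i : ℂ)) * Uᴴ - c • (U * diagonal (fun i => (b i : ℂ)) * Uᴴ) =
      U * diagonal (fun i => ((a i - c * b i : ℝ) : ℂ)) * Uᴴ := by
  have : diagonal (fun i => ((a i - c * b i : ℝ) : ℂ)) =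
      diagonal (fun i => (a i : ℂ)) - c • diagonal (fun i => (b i : ℂ)) := by
    ext i j
    by_cases h : i = j
    · subst h
      simp
    · simp [h]
  rw [this]
  simp only [Matrix.mul_sub, Matrix.sub_mul, Matrix.mul_smul, Matrix.smul_mul]

theorem conj_diagonal_posSemidef {U : Matrix n n ℂ} {a : n → ℝ} (ha : ∀ i, 0 ≤ a i) :
    (U * diagonal (fun i => (a i : ℂ)) * Uᴴ).PosSemidef :=
  (PosSemidef.diagonal fun i => Complex.zero_le_real.mpr (ha i)).mul_mul_conjTranspose_same _

/-- A state `ρ` can be replaced, up to factors controlled by the spectral range of `σ`,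
by its diagonal in an eigenbasis of an operator comparable to `σ`. -/
theorem exists_pinching_basis {ρ σ : Matrix n n ℂ} (hρ : IsDensity ρ) (hσ : IsDensity σ) {L : ℝ}
    (hL : 0 ≤ L) (h : (σ - Real.exp (-L) • (1 : Matrix n n ℂ)).PosSemidef) :
    ∃ (U : Matrix n n ℂ) (q : n → ℝ), U * Uᴴ = 1 ∧
      (∀ y, Real.exp (-(L + 1)) ≤ q y) ∧ (∀ y, q y ≤ 1) ∧
      (σ - U * diagonal (fun i => (q i : ℂ)) * Uᴴ).PosSemidef ∧
      ((L + 1) • (U * diagonal (fun i => ((((Uᴴ * ρ * U) i i).re : ℝ) : ℂ)) * Uᴴ)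
        - ρ).PosSemidef ∧
      ∀ α : ℝ, 1 / 2 ≤ α → α ≤ 1 → Real.exp (-(1 - α)) * sandQ α ρ σ ≤
        ∑ y, ((Uᴴ * ρ * U) y y).re ^ α * q y ^ (1 - α) := by
  obtain ⟨V, s, hV, hs0, hsσ⟩ := exists_spectral hσ.1
  have hV' : Vᴴ * V = 1 := mul_eq_one_comm.mp hV
  have hs1 := (hσ.eigen_le_one hV hs0 hsσ).2
  have hsL : ∀ i, Real.exp (-L) ≤ s i := by
    intro i
    have h1 : Vᴴ * (σ - Real.exp (-L) • (1 : Matrix n n ℂ)) * V =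
        diagonal (fun i => (s i : ℂ)) - Real.exp (-L) • (1 : Matrix n n ℂ) := by
      rw [Matrix.mul_sub, Matrix.sub_mul, Matrix.mul_smul, Matrix.smul_mul, mul_one, hV', hsσ]
      congr 1
      calc Vᴴ * (V * diagonal (fun i => (s i : ℂ)) * Vᴴ) * V
          = (Vᴴ * V) * diagonal (fun i => (s i : ℂ)) * (Vᴴ * V) := by simp only [mul_assoc]
        _ = _ := by rw [hV', one_mul, mul_one]
    have h2 := (h.conjTranspose_mul_mul_same V).diag_nonneg (i := i)
    rw [h1] at h2
    simp only [Matrix.sub_apply, diagonal_apply_eq, Matrix.smul_apply, one_apply_eq,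
      Complex.real_smul, mul_one, ← Complex.ofReal_sub] at h2
    have := Complex.zero_le_real.mp h2
    linarith
  have hspos : ∀ i, 0 < s i := fun i => (Real.exp_pos _).trans_le (hsL i)
  have hlog0 : ∀ i, 0 ≤ -Real.log (s i) := fun i => by
    have := Real.log_nonpos (hspos i).le (hs1 i)
    linarith
  have hlogL : ∀ i, -Real.log (s i) ≤ L := fun i => by
    have := (Real.le_log_iff_exp_le (hspos i)).mpr (hsL i)
    linarith
  let v : ℕ := ⌊L⌋₊ + 1
  let N : n → Fin v := fun y => ⟨⌊-Real.log (s y)⌋₊, Nat.lt_succ_of_le (Nat.floor_mono (hlogL y))⟩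
  have hvL : (v : ℝ) ≤ L + 1 := by
    have := Nat.floor_le hL
    simp only [v]
    push_cast
    linarith
  let q : n → ℝ := fun y => Real.exp (-((N y : ℕ) + 1 : ℝ))
  have hNle : ∀ y, ((N y : ℕ) : ℝ) ≤ -Real.log (s y) := fun y => Nat.floor_le (hlog0 y)
  have hNlt : ∀ y, -Real.log (s y) < ((N y : ℕ) : ℝ) + 1 := fun y => Nat.lt_floor_add_one _
  have hqs : ∀ y, q y ≤ s y := fun y => by
    rw [← Real.le_log_iff_exp_le (hspos y)]
    linarith [hNlt y]
  have hsq : ∀ y, Real.exp (-1) * s y ≤ q y := fun y => by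
    rw [← Real.exp_log (hspos y), ← Real.exp_add]
    refine Real.exp_le_exp.mpr ?_
    linarith [hNle y]
  have hq0 : ∀ y, 0 < q y := fun y => Real.exp_pos _
  have hRp : (Vᴴ * ρ * V).PosSemidef := hρ.1.conjTranspose_mul_mul_same V
  obtain ⟨U', hU', hUN, hUR⟩ := exists_blockwise_diagonalization N hRp.1
  let U := V * U'
  have hU : U * Uᴴ = 1 := by
    simp only [U, conjTranspose_mul]
    rw [show V * U' * (U'ᴴ * Vᴴ) = V * (U' * U'ᴴ) * Vᴴ by simp only [mul_assoc], hU', mul_one, hV]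
  have hT : Uᴴ * ρ * U = U'ᴴ * (Vᴴ * ρ * V) * U' := by
    simp only [U, conjTranspose_mul, mul_assoc]
  have hTp : (Uᴴ * ρ * U).PosSemidef := hρ.1.conjTranspose_mul_mul_same U
  have hp0 : ∀ y, 0 ≤ ((Uᴴ * ρ * U) y y).re := fun y => (Complex.le_def.mp hTp.diag_nonneg).1
  have hcomm : V * diagonal (fun i => (q i : ℂ)) * Vᴴ = U * diagonal (fun i => (q i : ℂ)) * Uᴴ := by
    have h1 : U' * diagonal (fun i => (q i : ℂ)) = diagonal (fun i => (q i : ℂ)) * U' := by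
      ext y z
      rw [mul_diagonal, diagonal_mul]
      by_cases hyz : N y = N z
      · simp only [q, hyz, mul_comm]
      · rw [hUN y z hyz, mul_zero, zero_mul]
    simp only [U, conjTranspose_mul]
    calc V * diagonal (fun i => (q i : ℂ)) * Vᴴ
        = V * (diagonal (fun i => (q i : ℂ)) * (U' * U'ᴴ)) * Vᴴ := by rw [hU', mul_one]
      _ = V * (diagonal (fun i => (q i : ℂ)) * U' * U'ᴴ) * Vᴴ := by rw [mul_assoc (diagonal _)]
      _ = V * (U' * diagonal (fun i => (q i : ℂ)) * U'ᴴ) * Vᴴ := by rw [h1]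
      _ = _ := by simp only [mul_assoc]
  have hσ'p : (U * diagonal (fun i => (q i : ℂ)) * Uᴴ).PosSemidef :=
    conj_diagonal_posSemidef fun i => (hq0 i).le
  refine ⟨U, q, hU, fun y => ?_, fun y => (hqs y).trans (hs1 y), ?_, ?_, fun α hα hα1 => ?_⟩
  · refine Real.exp_le_exp.mpr ?_
    linarith [hNle y, hlogL y]
  · rw [← hcomm]
    have := conj_diagonal_sub (U := V) s q 1
    rw [one_smul, ← hsσ] at this
    rw [this]
    exact conj_diagonal_posSemidef fun i => by linarith [hqs i]
  · have h1 := pinching_le N hTp fun y z hyz hN => by rw [hT]; exact hUR y z hyz hN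
    have h2 := h1.mul_mul_conjTranspose_same U
    have h3 : U * ((v : ℝ) • diagonal (fun y => (((Uᴴ * ρ * U) y y).re : ℂ)) - Uᴴ * ρ * U) * Uᴴ =
        (v : ℝ) • (U * diagonal (fun y => (((Uᴴ * ρ * U) y y).re : ℂ)) * Uᴴ) - ρ := by
      rw [Matrix.mul_sub, Matrix.sub_mul, Matrix.mul_smul, Matrix.smul_mul]
      congr 1
      calc U * (Uᴴ * ρ * U) * Uᴴ = (U * Uᴴ) * ρ * (U * Uᴴ) := by simp only [mul_assoc]
        _ = ρ := by rw [hU, one_mul, mul_one]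
    rw [h3] at h2
    have h4 := posSemidef_real_smul (conj_diagonal_posSemidef (U := U) hp0) (sub_nonneg.mpr hvL)
    have h5 := h2.add h4
    rw [sub_smul] at h5
    convert h5 using 1
    abel
  · have hα0 : 0 < α := by linarith
    have hmono := sandQ_mono hα hα1 hρ.1 hσ.1 hσ'p (Real.exp_pos (-1)).le (by
      rw [← hcomm, hsσ, conj_diagonal_sub]
      exact conj_diagonal_posSemidef fun i => by linarith [hsq i])
    rw [← Real.exp_mul, show -1 * (1 - α) = -(1 - α) by ring] at hmono
    refine hmono.trans ?_
    set t := (1 - α) / (2 * α) with ht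
    have hpw : matFun (fun x => x ^ t) (U * diagonal (fun i => (q i : ℂ)) * Uᴴ) =
        U * diagonal (fun i => ((q i ^ t : ℝ) : ℂ)) * Uᴴ := matFun_conj _ hU q
    refine (trace_rpow_le_sum_diag (sandwich_posSemidef hρ.1 hσ'p t) hU hα0.le hα1).trans
      (le_of_eq ?_)
    refine Finset.sum_congr rfl fun y _ => ?_
    have hU'' : Uᴴ * U = 1 := mul_eq_one_comm.mp hU
    have hX : Uᴴ * (matFun (fun x => x ^ t) (U * diagonal (fun i => (q i : ℂ)) * Uᴴ) * ρ *
        matFun (fun x => x ^ t) (U * diagonal (fun i => (q i : ℂ)) * Uᴴ)) * U =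
        diagonal (fun i => ((q i ^ t : ℝ) : ℂ)) * (Uᴴ * ρ * U) *
          diagonal (fun i => ((q i ^ t : ℝ) : ℂ)) := by
      rw [hpw]
      calc _ = (Uᴴ * U) * diagonal (fun i => ((q i ^ t : ℝ) : ℂ)) * (Uᴴ * ρ * U) *
          diagonal (fun i => ((q i ^ t : ℝ) : ℂ)) * (Uᴴ * U) := by simp only [mul_assoc]
        _ = _ := by rw [hU'', one_mul, mul_one]
    rw [hX, mul_diagonal, diagonal_mul, Complex.re_mul_ofReal, Complex.re_ofReal_mul]
    have hqt := Real.rpow_nonneg (hq0 y).le t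
    rw [Real.mul_rpow (mul_nonneg hqt (hp0 y)) hqt, Real.mul_rpow hqt (hp0 y),
      ← Real.rpow_mul (hq0 y).le, mul_right_comm, ← Real.rpow_add (hq0 y), mul_comm]
    congr 2
    rw [ht]
    field_simp
    ring

end

section
variable {n : Type*} [Fintype n] [DecidableEq n]

/-- Simulating a state by filtering it with a positive operator diagonal in the basis `U`. -/
theorem exists_filtered_state {ρ σ U : Matrix n n ℂ} (hρ : IsDensity ρ) (hσ : IsDensity σ)
    (hU : U * Uᴴ = 1) {p q a : n → ℝ} (hp : ∀ y, p y = ((Uᴴ * ρ * U) y y).re) {V M : ℝ}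
    (hpin : (V • (U * diagonal (fun i => (p i : ℂ)) * Uᴴ) - ρ).PosSemidef)
    (hq : (σ - U * diagonal (fun i => (q i : ℂ)) * Uᴴ).PosSemidef) (hM : 1 ≤ M)
    (ha : ∀ y, 0 ≤ a y) (hle : ∀ y, V * (a y ^ 2 * p y) ≤ M * q y)
    (hsum : ∑ y, a y ^ 2 * p y ≤ 1) :
    ∃ w : Matrix n n ℂ, IsDensity w ∧ (M • σ - w).PosSemidef ∧
      (∑ y, a y * p y) ^ 2 ≤ qFid ρ w := by
  have hU' : Uᴴ * U = 1 := mul_eq_one_comm.mp hU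
  have hTp : (Uᴴ * ρ * U).PosSemidef := hρ.1.conjTranspose_mul_mul_same U
  have hpc : ∀ y, (p y : ℂ) = (Uᴴ * ρ * U) y y := fun y => by
    rw [hp]; exact hTp.1.coe_re_apply_self y
  have hp0 : ∀ y, 0 ≤ p y := fun y => by
    rw [hp]; exact (Complex.le_def.mp hTp.diag_nonneg).1
  set A := U * diagonal (fun i => (a i : ℂ)) * Uᴴ with hA
  have hAp : A.PosSemidef := conj_diagonal_posSemidef ha
  have hw0 : (A * ρ * A).PosSemidef := posSemidef_mul_mul_self hρ.1 hAp
  have htr : ∀ b : n → ℝ, (U * diagonal (fun i => (b i : ℂ)) * Uᴴ * ρ).trace =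
      ((∑ y, b y * p y : ℝ) : ℂ) := by
    intro b
    rw [show U * diagonal (fun i => (b i : ℂ)) * Uᴴ * ρ =
      U * (diagonal (fun i => (b i : ℂ)) * Uᴴ * ρ) by simp only [mul_assoc], trace_mul_comm,
      show diagonal (fun i => (b i : ℂ)) * Uᴴ * ρ * U =
        diagonal (fun i => (b i : ℂ)) * (Uᴴ * ρ * U) by simp only [mul_assoc]]
    simp only [trace, diag_apply, diagonal_mul]
    push_cast
    exact Finset.sum_congr rfl fun y _ => by rw [hpc]
  have hconj : ∀ b c : n → ℝ, (U * diagonal (fun i => (b i : ℂ)) * Uᴴ) *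
      (U * diagonal (fun i => (c i : ℂ)) * Uᴴ) =
      U * diagonal (fun i => ((b i * c i : ℝ) : ℂ)) * Uᴴ := by
    intro b c
    calc _ = U * (diagonal (fun i => (b i : ℂ)) * ((Uᴴ * U) * diagonal (fun i => (c i : ℂ)))) * Uᴴ
          := by simp only [mul_assoc]
      _ = _ := by rw [hU', one_mul, diagonal_mul_diagonal]; push_cast; rfl
  set τ := ∑ y, a y ^ 2 * p y with hτ
  have hτ0 : 0 ≤ τ := Finset.sum_nonneg fun y _ => mul_nonneg (sq_nonneg _) (hp0 y)
  have hw0tr : (A * ρ * A).trace = (τ : ℂ) := by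
    rw [trace_mul_comm, ← mul_assoc, hA, hconj, htr]
    simp only [hτ, sq]
  have hlow : (M • σ - A * ρ * A).PosSemidef := by
    have h1 := posSemidef_mul_mul_self hpin hAp
    have h2 : A * (V • (U * diagonal (fun i => (p i : ℂ)) * Uᴴ) - ρ) * A =
        U * diagonal (fun i => ((V * (a i ^ 2 * p i) : ℝ) : ℂ)) * Uᴴ - A * ρ * A := by
      rw [Matrix.mul_sub, Matrix.sub_mul]
      congr 1
      rw [Matrix.mul_smul, Matrix.smul_mul, hA, hconj, hconj, ← Matrix.smul_mul,
        ← Matrix.mul_smul]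
      congr 2
      ext i j
      by_cases h : i = j
      · subst h
        simp only [Matrix.smul_apply, diagonal_apply_eq, Complex.real_smul]
        push_cast
        ring
      · simp [h]
    rw [h2] at h1
    have h3 : (U * diagonal (fun i => ((M * q i : ℝ) : ℂ)) * Uᴴ -
        U * diagonal (fun i => ((V * (a i ^ 2 * p i) : ℝ) : ℂ)) * Uᴴ).PosSemidef := by
      have := conj_diagonal_sub (U := U) (fun i => M * q i) (fun i => V * (a i ^ 2 * p i)) 1
      rw [one_smul] at this
      rw [this]
      exact conj_diagonal_posSemidef fun i => by linarith [hle i]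
    have h4 : M • (U * diagonal (fun i => (q i : ℂ)) * Uᴴ) =
        U * diagonal (fun i => ((M * q i : ℝ) : ℂ)) * Uᴴ := by
      rw [← Matrix.smul_mul, ← Matrix.mul_smul]
      congr 2
      ext i j
      by_cases h : i = j
      · subst h
        simp [Complex.real_smul]
      · simp [h]
    have h5 := posSemidef_real_smul hq (c := M) (by linarith)
    rw [smul_sub, h4] at h5
    convert (h5.add h3).add h1 using 1
    abel
  set c := (1 - τ) / (M - τ) with hc
  have hc0 : 0 ≤ c := div_nonneg (by linarith) (by linarith)
  have hc1 : c ≤ 1 := div_le_one_of_le₀ (by linarith) (by linarith)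
  have hcτ : τ + c * (M - τ) = 1 := by
    by_cases h : M - τ = 0
    · rw [hc, h]
      simp
      linarith
    · rw [hc, div_mul_cancel₀ _ h]
      ring
  have hcp := posSemidef_real_smul hlow hc0
  refine ⟨A * ρ * A + c • (M • σ - A * ρ * A), ⟨hw0.add hcp, ?_⟩, ?_, ?_⟩
  · rw [trace_add, trace_smul, trace_sub, trace_smul, hσ.2, hw0tr]
    simp only [Complex.real_smul, mul_one]
    exact_mod_cast hcτ
  · convert posSemidef_real_smul hlow (sub_nonneg.mpr hc1) using 1
    rw [sub_smul, one_smul]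
    abel
  · set S := matFun Real.sqrt ρ with hS
    have hS' : S = matFun (fun t => t ^ (1 / 2 : ℝ)) ρ := matFun_sqrt ρ
    have hSp : S.PosSemidef := by rw [hS']; exact matFun_rpow_posSemidef hρ.1 _
    have hSS : S * S = ρ := by rw [hS']; exact matFun_half_mul_self hρ.1
    have h1 : S * (A * ρ * A) * S = (S * A * S) * (S * A * S) := by
      rw [← hSS]; simp only [mul_assoc]
    have h2 : (S * A * S).PosSemidef := posSemidef_mul_mul_self hAp hSp
    have h3 : (matFun Real.sqrt (S * (A * ρ * A) * S)).trace.re = ∑ y, a y * p y := by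
      rw [h1, matFun_sqrt_sq h2, trace_mul_comm, ← mul_assoc, hSS, trace_mul_comm, hA, htr]
      exact Complex.ofReal_re _
    have h4 : 0 ≤ ∑ y, a y * p y := Finset.sum_nonneg fun y _ => mul_nonneg (ha y) (hp0 y)
    rw [qFid, ← hS]
    refine pow_le_pow_left₀ h4 ?_ 2
    rw [← h3, matFun_sqrt, matFun_sqrt]
    refine trace_re_mono (matFun_rpow_mono (posSemidef_mul_mul_self hw0 hSp)
      (posSemidef_mul_mul_self (hw0.add hcp) hSp) ?_ (by norm_num) (by norm_num))
    rw [← Matrix.sub_mul, ← Matrix.mul_sub, add_sub_cancel_left]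
    exact posSemidef_mul_mul_self hcp hSp

end

/-- The variance of a sum of independent centered variables, for finitely supported weights. -/
theorem sum_prod_mul_sum_sq {ι I : Type*} {C : ι → Type*} [Fintype ι] [Fintype I]
    [∀ b, Fintype (C b)] {e : I → ∀ b, C b} (he : Function.Bijective e) {w g : ∀ b, C b → ℝ}
    (hw : ∀ b, ∑ c, w b c = 1) (hg : ∀ b, ∑ c, w b c * g b c = 0) :
    ∑ x, (∏ b, w b (e x b)) * (∑ b, g b (e x b)) ^ 2 = ∑ b, ∑ c, w b c * g b c ^ 2 := by
  have h : ∀ b b', ∑ x, (∏ i, w i (e x i)) * (g b (e x b) * g b' (e x b')) =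
      if b = b' then ∑ c, w b c * g b c ^ 2 else 0 := by
    intro b b'
    have h1 : ∀ x, (∏ i, w i (e x i)) * (g b (e x b) * g b' (e x b')) =
        ∏ i, (w i (e x i) * (if i = b then g i (e x i) else 1) *
          (if i = b' then g i (e x i) else 1)) := by
      intro x
      simp only [Finset.prod_mul_distrib, Finset.prod_ite_eq', Finset.mem_univ, if_true]
      ring
    simp only [h1]
    rw [sum_prod_comp he (fun i c => w i c * (if i = b then g i c else 1) *
      (if i = b' then g i c else 1))]
    split_ifs with hbb
    · subst hbb
      rw [Finset.prod_eq_single b]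
      · simp only [if_true]
        exact Finset.sum_congr rfl fun c _ => by ring
      · intro i _ hi
        simp [hi, hw]
      · simp
    · refine Finset.prod_eq_zero (Finset.mem_univ b) ?_
      simp [hbb, hg]
  have hx : ∀ x, (∏ b, w b (e x b)) * (∑ b, g b (e x b)) ^ 2 =
      ∑ b, ∑ b', (∏ i, w i (e x i)) * (g b (e x b) * g b' (e x b')) := by
    intro x
    rw [sq, Finset.sum_mul_sum, Finset.mul_sum]
    exact Finset.sum_congr rfl fun b _ => Finset.mul_sum _ _ _
  simp only [hx]
  rw [Finset.sum_comm]
  refine Finset.sum_congr rfl fun b _ => ?_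
  rw [Finset.sum_comm]
  simp [h]

section
variable {C : Type*}

/-- The geometric interpolation `p^α q^{1-α}` with `α = 1 / (1 + t)`. -/
def tilt (p q : C → ℝ) (t : ℝ) (c : C) : ℝ :=
  if p c = 0 then 0 else q c * Real.exp (Real.log (p c / q c) / (1 + t))

/-- The total mass of `tilt p q t`. -/
def tiltZ [Fintype C] (p q : C → ℝ) (t : ℝ) : ℝ := ∑ c, tilt p q t c

variable {p q : C → ℝ} {L : ℝ}

theorem tilt_eq_rpow (hp : ∀ c, 0 ≤ p c) (hq : ∀ c, 0 < q c) {t : ℝ} (ht : 0 ≤ t) (c : C) :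
    tilt p q t c = p c ^ (1 / (1 + t)) * q c ^ (1 - 1 / (1 + t)) := by
  have h1 : 0 < 1 + t := by linarith
  unfold tilt
  split_ifs with h
  · rw [h, Real.zero_rpow (by positivity), zero_mul]
  · have hp' : 0 < p c := lt_of_le_of_ne (hp c) (Ne.symm h)
    rw [Real.log_div h (hq c).ne', Real.rpow_def_of_pos hp', Real.rpow_def_of_pos (hq c),
      ← Real.exp_add]
    nth_rewrite 1 [← Real.exp_log (hq c)]
    rw [← Real.exp_add]
    congr 1
    ring

theorem tilt_nonneg (hq : ∀ c, 0 < q c) (t : ℝ) (c : C) : 0 ≤ tilt p q t c := by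
  unfold tilt
  split_ifs
  · exact le_rfl
  · exact mul_nonneg (hq c).le (Real.exp_pos _).le

variable [Fintype C]

theorem le_one_of_sum_eq_one (hp : ∀ c, 0 ≤ p c) (hp1 : ∑ c, p c = 1) (c : C) : p c ≤ 1 := by
  rw [← hp1]
  exact Finset.single_le_sum (fun c _ => hp c) (Finset.mem_univ c)

theorem log_div_le (hp : ∀ c, 0 ≤ p c) (hp1 : ∑ c, p c = 1) (hq : ∀ c, Real.exp (-L) ≤ q c)
    {c : C} (h : p c ≠ 0) : Real.log (p c / q c) ≤ L := by
  have hq0 := (Real.exp_pos (-L)).trans_le (hq c)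
  have hp' : 0 < p c := lt_of_le_of_ne (hp c) (Ne.symm h)
  rw [Real.log_div h hq0.ne']
  have := Real.log_nonpos hp'.le (le_one_of_sum_eq_one hp hp1 c)
  have := (Real.le_log_iff_exp_le hq0).mpr (hq c)
  linarith

theorem tiltZ_pos (hp1 : ∑ c, p c = 1) (hq : ∀ c, 0 < q c) (t : ℝ) :
    0 < tiltZ p q t := by
  obtain ⟨c, -, hc⟩ := Finset.exists_ne_zero_of_sum_ne_zero (by rw [hp1]; exact one_ne_zero)
  refine Finset.sum_pos' (fun c _ => tilt_nonneg hq t c) ⟨c, Finset.mem_univ _, ?_⟩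
  rw [tilt, if_neg hc]
  exact mul_pos (hq c) (Real.exp_pos _)

theorem exp_le_tiltZ (hp : ∀ c, 0 ≤ p c) (hp1 : ∑ c, p c = 1)
    (hq : ∀ c, Real.exp (-L) ≤ q c) (hL : 0 ≤ L) {t : ℝ} (ht : 0 ≤ t) (ht1 : t ≤ 1) :
    Real.exp (-(L / 2)) ≤ tiltZ p q t := by
  have h : ∀ c, Real.exp (-(L / 2)) * p c ≤ tilt p q t c := by
    intro c
    unfold tilt
    split_ifs with h
    · simp [h]
    · have hq0 := (Real.exp_pos (-L)).trans_le (hq c)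
      have hp' : 0 < p c := lt_of_le_of_ne (hp c) (Ne.symm h)
      have hl := log_div_le hp hp1 hq h
      have hpq : p c = q c * Real.exp (Real.log (p c / q c)) := by
        rw [Real.exp_log (div_pos hp' hq0), mul_div_cancel₀ _ hq0.ne']
      set l := Real.log (p c / q c)
      rw [hpq, mul_left_comm, ← Real.exp_add]
      refine mul_le_mul_of_nonneg_left (Real.exp_le_exp.mpr ?_) hq0.le
      have h2 : l - l / (1 + t) = (t / (1 + t)) * l := by
        field_simp
        ring
      have h3 : t / (1 + t) ≤ 1 / 2 := by
        rw [div_le_div_iff₀ (by linarith) (by norm_num)]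
        linarith
      have h4 : (t / (1 + t)) * l ≤ (t / (1 + t)) * L :=
        mul_le_mul_of_nonneg_left hl (div_nonneg ht (by linarith))
      have h5 : (t / (1 + t)) * L ≤ 1 / 2 * L := mul_le_mul_of_nonneg_right h3 hL
      linarith
  calc Real.exp (-(L / 2)) = ∑ c, Real.exp (-(L / 2)) * p c := by
        rw [← Finset.mul_sum, hp1, mul_one]
    _ ≤ _ := Finset.sum_le_sum fun c _ => h c

theorem sum_tilt_div (hp1 : ∑ c, p c = 1) (hq : ∀ c, 0 < q c) (t : ℝ) :
    ∑ c, tilt p q t c / tiltZ p q t = 1 := by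
  rw [← Finset.sum_div]
  exact div_self (tiltZ_pos hp1 hq t).ne'

/-- The mean of the log-likelihood ratio under the normalized tilted distribution. -/
def tiltMean (p q : C → ℝ) (t : ℝ) : ℝ :=
  ∑ c, tilt p q t c / tiltZ p q t * Real.log (p c / q c)

theorem hasDerivAt_tiltZ (hp1 : ∑ c, p c = 1) (hq : ∀ c, 0 < q c) {t : ℝ} (ht : 0 ≤ t) :
    HasDerivAt (fun t => -(1 + t) * Real.log (tiltZ p q t))
      (tiltMean p q t / (1 + t) - Real.log (tiltZ p q t)) t := by
  have h1 : (1 + t) ≠ 0 := by linarith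
  have hZ := (tiltZ_pos hp1 hq t).ne'
  have hd1 : HasDerivAt (fun t : ℝ => 1 + t) 1 t := by
    simpa using (hasDerivAt_id t).const_add 1
  have hd : ∀ c, HasDerivAt (fun t => tilt p q t c)
      (tilt p q t c * Real.log (p c / q c) * (-1 / (1 + t) ^ 2)) t := by
    intro c
    unfold tilt
    split_ifs with h
    · simpa using hasDerivAt_const t (0 : ℝ)
    · have h3 := ((((hasDerivAt_const t (Real.log (p c / q c))).div hd1 h1).exp).const_mul (q c))
      refine h3.congr_deriv ?_
      simp only [Pi.div_apply]
      ring
  have hs : HasDerivAt (fun t => tiltZ p q t)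
      (∑ c, tilt p q t c * Real.log (p c / q c) * (-1 / (1 + t) ^ 2)) t :=
    HasDerivAt.fun_sum fun c _ => hd c
  have hfin := (hd1.neg).mul (hs.log hZ)
  refine hfin.congr_deriv ?_
  rw [← Finset.sum_mul, tiltMean]
  simp_rw [div_mul_eq_mul_div]
  rw [← Finset.sum_div]
  simp only [Pi.neg_apply]
  field_simp
  ring

theorem tiltMean_div_sub_log_le (hp1 : ∑ c, p c = 1)
    (hq : ∀ c, Real.exp (-L) ≤ q c) (t : ℝ) :
    tiltMean p q t / (1 + t) - Real.log (tiltZ p q t) ≤ L := by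
  have hq0 : ∀ c, 0 < q c := fun c => (Real.exp_pos (-L)).trans_le (hq c)
  have hZ := tiltZ_pos hp1 hq0 t
  have hs := sum_tilt_div hp1 hq0 t
  have h0 : ∀ c, 0 ≤ tilt p q t c / tiltZ p q t := fun c => div_nonneg (tilt_nonneg hq0 t c) hZ.le
  have : tiltMean p q t / (1 + t) - Real.log (tiltZ p q t) = ∑ c, tilt p q t c / tiltZ p q t *
      (Real.log (p c / q c) / (1 + t) - Real.log (tiltZ p q t)) := by
    simp only [mul_sub, Finset.sum_sub_distrib, ← Finset.sum_mul, hs, one_mul]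
    rw [tiltMean, Finset.sum_div]
    congr 1
    exact Finset.sum_congr rfl fun c _ => by ring
  rw [this]
  calc _ ≤ ∑ c, tilt p q t c / tiltZ p q t * L := by
        refine Finset.sum_le_sum fun c _ => ?_
        by_cases h : p c = 0
        · simp [tilt, h]
        · refine mul_le_mul_of_nonneg_left ?_ (h0 c)
          have h1 := le_one_of_sum_eq_one h0 hs c
          have h2 : tilt p q t c / tiltZ p q t =
              q c * Real.exp (Real.log (p c / q c) / (1 + t) - Real.log (tiltZ p q t)) := by
            rw [tilt, if_neg h, Real.exp_sub, Real.exp_log hZ, mul_div_assoc]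
          set y := Real.log (p c / q c) / (1 + t) - Real.log (tiltZ p q t)
          have h3 : Real.exp (-L) * Real.exp y ≤ 1 :=
            (mul_le_mul_of_nonneg_right (hq c) (Real.exp_pos y).le).trans (h2 ▸ h1)
          rw [← Real.exp_add, Real.exp_le_one_iff] at h3
          linarith
    _ = L := by rw [← Finset.sum_mul, hs, one_mul]

theorem tilt_second_moment (hp : ∀ c, 0 ≤ p c) (hp1 : ∑ c, p c = 1)
    (hq : ∀ c, Real.exp (-L) ≤ q c) (hq1 : ∑ c, q c ≤ 1) (hL : 0 ≤ L) {t : ℝ} (ht : 0 ≤ t)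
    (ht1 : t ≤ 1) :
    ∑ c, tilt p q t c / tiltZ p q t * Real.log (p c / q c) ^ 2 ≤ 4 * L ^ 2 + 32 := by
  have hq0 : ∀ c, 0 < q c := fun c => (Real.exp_pos (-L)).trans_le (hq c)
  have hZ := tiltZ_pos hp1 hq0 t
  have hZL := exp_le_tiltZ hp hp1 hq hL ht ht1
  have hs := sum_tilt_div hp1 hq0 t
  have h0 : ∀ c, 0 ≤ tilt p q t c / tiltZ p q t := fun c => div_nonneg (tilt_nonneg hq0 t c) hZ.le
  have key : ∀ c, tilt p q t c / tiltZ p q t * Real.log (p c / q c) ^ 2 ≤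
      tilt p q t c / tiltZ p q t * (4 * L ^ 2) + q c * 32 := by
    intro c
    by_cases h : p c = 0
    · simp [tilt, h, (hq0 c).le]
    have hl := log_div_le hp hp1 hq h
    by_cases h2 : -(2 * L) ≤ Real.log (p c / q c)
    · have : Real.log (p c / q c) ^ 2 ≤ 4 * L ^ 2 := by nlinarith
      have := mul_le_mul_of_nonneg_left this (h0 c)
      linarith [hq0 c]
    · push Not at h2
      have h3 : tilt p q t c / tiltZ p q t ≤ q c * Real.exp (Real.log (p c / q c) / 4) := by
        rw [div_le_iff₀ hZ, tilt, if_neg h]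
        set l := Real.log (p c / q c)
        have h4 : q c * Real.exp (l / (1 + t)) ≤
            q c * Real.exp (l / 4) * Real.exp (-(L / 2)) := by
          rw [mul_assoc, ← Real.exp_add]
          refine mul_le_mul_of_nonneg_left (Real.exp_le_exp.mpr ?_) (hq0 c).le
          have : l / (1 + t) ≤ l / 2 := by
            rw [div_le_div_iff₀ (by linarith) (by norm_num)]
            nlinarith
          linarith
        exact h4.trans (mul_le_mul_of_nonneg_left hZL (by have := hq0 c; positivity))
      set l := Real.log (p c / q c)
      have h5 : Real.exp (l / 4) * l ^ 2 ≤ 32 := by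
        have h6 := Real.quadratic_le_exp_of_nonneg (x := -(l / 4)) (by linarith)
        rw [Real.exp_neg] at h6
        have h7 : l ^ 2 / 32 ≤ (Real.exp (l / 4))⁻¹ := by
          refine le_trans ?_ h6
          nlinarith
        have h8 := mul_le_mul_of_nonneg_left h7 (Real.exp_pos (l / 4)).le
        rw [mul_inv_cancel₀ (Real.exp_pos _).ne'] at h8
        linarith
      have h9 := mul_le_mul_of_nonneg_right h3 (sq_nonneg l)
      have h10 := mul_le_mul_of_nonneg_left h5 (hq0 c).le
      have h11 := mul_nonneg (h0 c) (by positivity : 0 ≤ 4 * L ^ 2)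
      linarith
  calc _ ≤ ∑ c, (tilt p q t c / tiltZ p q t * (4 * L ^ 2) + q c * 32) :=
        Finset.sum_le_sum fun c _ => key c
    _ = 4 * L ^ 2 + (∑ c, q c) * 32 := by
        rw [Finset.sum_add_distrib, ← Finset.sum_mul, ← Finset.sum_mul, hs, one_mul]
    _ ≤ _ := by linarith

end

theorem exists_max_deriv_le_mul {S S' : ℝ → ℝ}
    (h : ∀ t ∈ Set.Icc (0 : ℝ) 1, HasDerivAt S (S' t) t) :
    ∃ t ∈ Set.Icc (0 : ℝ) 1, max (S' t) 0 ≤ t * S' t := by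
  by_cases h0 : S' 0 ≤ 0
  · exact ⟨0, by simp, by simp [h0]⟩
  by_cases h1 : 0 ≤ S' 1
  · exact ⟨1, by simp, by simp [h1]⟩
  push Not at h0 h1
  obtain ⟨t, ht, h2⟩ := exists_hasDerivWithinAt_eq_of_lt_of_gt zero_le_one
    (fun x hx => (h x hx).hasDerivWithinAt) h0 h1
  exact ⟨t, Set.Ioo_subset_Icc_self ht, by simp [h2]⟩

section
variable {ι I : Type*} {C : ι → Type*} [Fintype ι] [Nonempty ι] [Fintype I] [∀ b, Fintype (C b)]
  {e : I → ∀ b, C b} {p q : ∀ b, C b → ℝ} {L R V : ℝ}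

/-- The exponent function of the product problem. -/
def tiltExponent (p q : ∀ b, C b → ℝ) (R t : ℝ) : ℝ :=
  ∑ b, -(1 + t) * Real.log (tiltZ (p b) (q b) t) - t * R

/-- The derivative of `tiltExponent`. -/
def tiltExponentDeriv (p q : ∀ b, C b → ℝ) (R t : ℝ) : ℝ :=
  ∑ b, (tiltMean (p b) (q b) t / (1 + t) - Real.log (tiltZ (p b) (q b) t)) - R

theorem exists_filter_of_max_le (he : Function.Bijective e) (hp : ∀ b c, 0 ≤ p b c)
    (hp1 : ∀ b, ∑ c, p b c = 1) (hq : ∀ b c, Real.exp (-L) ≤ q b c) (hq1 : ∀ b, ∑ c, q b c ≤ 1)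
    (hL : 0 ≤ L) (hV : 1 ≤ V) {t : ℝ} (ht : t ∈ Set.Icc (0 : ℝ) 1)
    (hD : max (tiltExponentDeriv p q R t) 0 ≤ t * tiltExponentDeriv p q R t) :
    ∃ a : I → ℝ, (∀ x, 0 ≤ a x) ∧ ∑ x, a x ^ 2 * ∏ b, p b (e x b) ≤ 1 ∧
      (∀ x, V * (a x ^ 2 * ∏ b, p b (e x b)) ≤ Real.exp R * ∏ b, q b (e x b)) ∧
      Real.exp (-tiltExponent p q R t - 2 * √(2 * (Fintype.card ι * (4 * L ^ 2 + 32))) -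
        Real.log V) / 4 ≤ (∑ x, a x * ∏ b, p b (e x b)) ^ 2 := by
  have hq0 : ∀ b c, 0 < q b c := fun b c => (Real.exp_pos (-L)).trans_le (hq b c)
  have hZ := fun b => tiltZ_pos (hp1 b) (hq0 b) t
  let w : ∀ b, C b → ℝ := fun b c => tilt (p b) (q b) t c / tiltZ (p b) (q b) t
  let m : ι → ℝ := fun b => tiltMean (p b) (q b) t
  let g : ∀ b, C b → ℝ := fun b c => Real.log (p b c / q b c) - m b
  have hw0 : ∀ b c, 0 ≤ w b c := fun b c => div_nonneg (tilt_nonneg (hq0 b) t c) (hZ b).le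
  have hw1 : ∀ b, ∑ c, w b c = 1 := fun b => sum_tilt_div (hp1 b) (hq0 b) t
  have hm : ∀ b, ∑ c, w b c * Real.log (p b c / q b c) = m b := fun b => rfl
  have hg : ∀ b, ∑ c, w b c * g b c = 0 := by
    intro b
    simp only [g, mul_sub, Finset.sum_sub_distrib, ← Finset.sum_mul, hw1, hm, one_mul, sub_self]
  have hvar : ∀ b, ∑ c, w b c * g b c ^ 2 ≤ 4 * L ^ 2 + 32 := by
    intro b
    refine le_trans ?_ (tilt_second_moment (hp b) (hp1 b) (hq b) (hq1 b) hL ht.1 ht.2)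
    have : ∑ c, w b c * g b c ^ 2 = ∑ c, w b c * Real.log (p b c / q b c) ^ 2 - m b ^ 2 := by
      have h1 : ∀ c, w b c * g b c ^ 2 = w b c * Real.log (p b c / q b c) ^ 2
          - (w b c * Real.log (p b c / q b c)) * (2 * m b) + w b c * m b ^ 2 := fun c => by
        simp only [g]; ring
      simp only [h1, Finset.sum_add_distrib, Finset.sum_sub_distrib, ← Finset.sum_mul, hw1, hm]
      ring
    rw [this]
    have := sq_nonneg (m b)
    simp only [w]
    linarith
  set δ := √(2 * (Fintype.card ι * (4 * L ^ 2 + 32))) with hδ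
  have hδ0 : 0 ≤ δ := Real.sqrt_nonneg _
  have hδ2 : δ ^ 2 = 2 * (Fintype.card ι * (4 * L ^ 2 + 32)) := Real.sq_sqrt (by positivity)
  have hcard : (0 : ℝ) < Fintype.card ι := by exact_mod_cast Fintype.card_pos
  let Wx : I → ℝ := fun x => ∏ b, w b (e x b)
  let G : I → ℝ := fun x => ∑ b, g b (e x b)
  have hWx0 : ∀ x, 0 ≤ Wx x := fun x => Finset.prod_nonneg fun b _ => hw0 b _
  have hWx1 : ∑ x, Wx x = 1 := by
    simp only [Wx]
    rw [sum_prod_comp he w]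
    simp [hw1]
  have hV2 : ∑ x, Wx x * G x ^ 2 ≤ δ ^ 2 / 2 := by
    have h1 := sum_prod_mul_sum_sq he hw1 hg
    have h2 : ∑ b, ∑ c, w b c * g b c ^ 2 ≤ ∑ _b : ι, (4 * L ^ 2 + 32) :=
      Finset.sum_le_sum fun b _ => hvar b
    rw [← h1, Finset.sum_const, Finset.card_univ, nsmul_eq_mul] at h2
    rw [hδ2]
    simp only [Wx, G]
    linarith
  let A : I → Prop := fun x => (∀ b, p b (e x b) ≠ 0) ∧ |G x| ≤ δ
  have hWA : 1 / 2 ≤ ∑ x, if A x then Wx x else 0 := by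
    have h1 : ∀ x, Wx x * δ ^ 2 ≤ (if A x then Wx x else 0) * δ ^ 2 + Wx x * G x ^ 2 := by
      intro x
      split_ifs with h
      · have := mul_nonneg (hWx0 x) (sq_nonneg (G x))
        linarith
      · rw [zero_mul, zero_add]
        by_cases h3 : ∀ b, p b (e x b) ≠ 0
        · have h4 : δ < |G x| := by
            by_contra h5
            exact h ⟨h3, not_lt.mp h5⟩
          refine mul_le_mul_of_nonneg_left ?_ (hWx0 x)
          rw [← sq_abs (G x)]
          exact pow_le_pow_left₀ hδ0 h4.le 2
        · push Not at h3
          obtain ⟨b, hb⟩ := h3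
          have : Wx x = 0 := Finset.prod_eq_zero (Finset.mem_univ b) (by simp [w, tilt, hb])
          simp [this]
    have h2 := Finset.sum_le_sum fun x (_ : x ∈ Finset.univ) => h1 x
    rw [Finset.sum_add_distrib, ← Finset.sum_mul, ← Finset.sum_mul, hWx1] at h2
    have h3 : 0 < δ ^ 2 := by rw [hδ2]; positivity
    nlinarith
  set D := tiltExponentDeriv p q R t with hDdef
  set α := 1 / (1 + t) with hα
  have ht1 : 0 < 1 + t := by linarith [ht.1]
  have hα1 : α * (1 + t) = 1 := by rw [hα]; field_simp
  have hα0 : 0 < α := by positivity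
  have hαle : α ≤ 1 := by nlinarith [ht.1]
  set Λ := ∑ b, Real.log (tiltZ (p b) (q b) t) with hΛ
  set μ := ∑ b, m b with hμ
  have hDμ : α * μ = D + R + Λ := by
    simp only [hDdef, tiltExponentDeriv, hΛ, hμ, m, Finset.sum_sub_distrib, ← Finset.sum_div, hα]
    ring
  have hS : tiltExponent p q R t = -(1 + t) * Λ - t * R := by
    rw [tiltExponent, hΛ, Finset.mul_sum]
  let l : I → ℝ := fun x => ∑ b, Real.log (p b (e x b) / q b (e x b))
  have hGl : ∀ x, G x = l x - μ := fun x => by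
    simp only [G, g, l, hμ, Finset.sum_sub_distrib]
  let P : I → ℝ := fun x => ∏ b, p b (e x b)
  let Q : I → ℝ := fun x => ∏ b, q b (e x b)
  have hQ0 : ∀ x, 0 < Q x := fun x => Finset.prod_pos fun b _ => hq0 b _
  have hPQ : ∀ x, A x → P x = Q x * Real.exp (l x) := by
    intro x hx
    simp only [P, Q, l, Real.exp_sum, ← Finset.prod_mul_distrib]
    refine Finset.prod_congr rfl fun b _ => ?_
    have hp' : 0 < p b (e x b) := lt_of_le_of_ne (hp _ _) (Ne.symm (hx.1 b))
    rw [Real.exp_log (div_pos hp' (hq0 _ _)), mul_div_cancel₀ _ (hq0 _ _).ne']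
  have hWQ : ∀ x, A x → Wx x = Q x * Real.exp (α * l x - Λ) := by
    intro x hx
    simp only [Wx, Q, l, hΛ, Finset.mul_sum, ← Finset.sum_sub_distrib, Real.exp_sum,
      ← Finset.prod_mul_distrib]
    refine Finset.prod_congr rfl fun b _ => ?_
    simp only [w]
    rw [tilt, if_neg (hx.1 b), Real.exp_sub, Real.exp_log (hZ b), mul_div_assoc, hα,
      one_div_mul_eq_div]
  set κ := -(max D 0) - δ - Real.log V with hκ
  have hlogV : 0 ≤ Real.log V := Real.log_nonneg hV
  have hDm := le_max_left D 0
  have hD0 := le_max_right D 0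
  let a : I → ℝ := fun x => if A x then Real.exp ((κ + (α - 1) * l x - Λ) / 2) else 0
  have ha2 : ∀ x, a x ^ 2 * P x = Real.exp κ * if A x then Wx x else 0 := by
    intro x
    simp only [a]
    split_ifs with h
    · rw [hWQ x h, hPQ x h, ← Real.exp_nat_mul]
      rw [mul_left_comm, mul_left_comm (Real.exp κ), ← Real.exp_add, ← Real.exp_add]
      congr 2
      push_cast
      ring
    · simp
  refine ⟨a, fun x => ?_, ?_, fun x => ?_, ?_⟩
  · simp only [a]
    split_ifs
    · exact (Real.exp_pos _).le
    · exact le_rfl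
  · change ∑ x, a x ^ 2 * P x ≤ 1
    simp only [ha2, ← Finset.mul_sum]
    have h1 : ∑ x, (if A x then Wx x else 0) ≤ 1 := by
      rw [← hWx1]
      refine Finset.sum_le_sum fun x _ => ?_
      split_ifs
      · exact le_rfl
      · exact hWx0 x
    have h2 : Real.exp κ ≤ 1 := Real.exp_le_one_iff.mpr (by linarith)
    have h3 : (0 : ℝ) ≤ ∑ x, (if A x then Wx x else 0) := by linarith
    nlinarith [Real.exp_pos κ]
  · change V * (a x ^ 2 * P x) ≤ Real.exp R * Q x
    rw [ha2]
    split_ifs with h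
    · rw [hWQ x h]
      have h1 := (abs_le.mp h.2).2
      rw [hGl] at h1
      nth_rewrite 1 [← Real.exp_log (zero_lt_one.trans_le hV)]
      rw [mul_left_comm (Real.exp κ), mul_left_comm, ← Real.exp_add, ← Real.exp_add,
        mul_comm (Real.exp R)]
      refine mul_le_mul_of_nonneg_left (Real.exp_le_exp.mpr ?_) (hQ0 x).le
      have h2 : α * l x ≤ α * (μ + δ) := mul_le_mul_of_nonneg_left (by linarith) hα0.le
      have h3 : α * δ ≤ 1 * δ := mul_le_mul_of_nonneg_right hαle hδ0
      rw [hκ]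
      linarith
    · simpa using (mul_pos (Real.exp_pos R) (hQ0 x)).le
  · set E := Real.exp ((κ + (1 - α) * (μ - δ) + Λ) / 2) with hE
    have haP : ∀ x, E * (if A x then Wx x else 0) ≤ a x * P x := by
      intro x
      simp only [a]
      split_ifs with h
      · rw [hWQ x h, hPQ x h, mul_left_comm, mul_left_comm (Real.exp ((κ + (α - 1) * l x - Λ) / 2)),
          ← Real.exp_add, ← Real.exp_add]
        refine mul_le_mul_of_nonneg_left (Real.exp_le_exp.mpr ?_) (hQ0 x).le
        have h1 := (abs_le.mp h.2).1
        rw [hGl] at h1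
        have h2 : (1 - α) * (μ - δ) ≤ (1 - α) * l x :=
          mul_le_mul_of_nonneg_left (by linarith) (by linarith)
        linarith
      · simp
    have h1 : E * (1 / 2) ≤ ∑ x, a x * P x := by
      refine (mul_le_mul_of_nonneg_left hWA (Real.exp_pos _).le).trans ?_
      rw [Finset.mul_sum]
      exact Finset.sum_le_sum fun x _ => haP x
    have h2 : (E * (1 / 2)) ^ 2 ≤ (∑ x, a x * P x) ^ 2 :=
      pow_le_pow_left₀ (by have := Real.exp_pos ((κ + (1 - α) * (μ - δ) + Λ) / 2); positivity) h1 2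
    refine le_trans ?_ h2
    rw [mul_pow, hE, ← Real.exp_nat_mul]
    have h3 : Real.exp (-tiltExponent p q R t - 2 * δ - Real.log V) ≤
        Real.exp ((2 : ℕ) * ((κ + (1 - α) * (μ - δ) + Λ) / 2)) := by
      refine Real.exp_le_exp.mpr ?_
      push_cast
      rw [hS, hκ]
      have h4 : (1 - α) * μ = t * (D + R + Λ) := by
        rw [← hDμ]
        linear_combination (-μ) * hα1
      have h5 : (1 - α) * δ ≤ δ := by nlinarith
      nlinarith
    linarith

/-- A filter achieving the optimal exponent at a point `t` where the exponent is nearly maximal. -/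
theorem exists_filter (he : Function.Bijective e) (hp : ∀ b c, 0 ≤ p b c)
    (hp1 : ∀ b, ∑ c, p b c = 1) (hq : ∀ b c, Real.exp (-L) ≤ q b c) (hq1 : ∀ b, ∑ c, q b c ≤ 1)
    (hL : 0 ≤ L) (hR : 0 ≤ R) (hV : 1 ≤ V) :
    ∃ t ∈ Set.Icc (0 : ℝ) 1, (∀ t' ∈ Set.Icc (0 : ℝ) t,
      tiltExponent p q R t ≤ tiltExponent p q R t' + Fintype.card ι * L * (t - t')) ∧
      ∃ a : I → ℝ, (∀ x, 0 ≤ a x) ∧ ∑ x, a x ^ 2 * ∏ b, p b (e x b) ≤ 1 ∧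
      (∀ x, V * (a x ^ 2 * ∏ b, p b (e x b)) ≤ Real.exp R * ∏ b, q b (e x b)) ∧
      Real.exp (-tiltExponent p q R t - 2 * √(2 * (Fintype.card ι * (4 * L ^ 2 + 32))) -
        Real.log V) / 4 ≤ (∑ x, a x * ∏ b, p b (e x b)) ^ 2 := by
  have hq0 : ∀ b c, 0 < q b c := fun b c => (Real.exp_pos (-L)).trans_le (hq b c)
  have hd : ∀ t ∈ Set.Icc (0 : ℝ) 1,
      HasDerivAt (tiltExponent p q R) (tiltExponentDeriv p q R t) t := by
    intro t ht
    have h1 : HasDerivAt (fun t => ∑ b, -(1 + t) * Real.log (tiltZ (p b) (q b) t))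
      (∑ b, (tiltMean (p b) (q b) t / (1 + t) - Real.log (tiltZ (p b) (q b) t))) t :=
      HasDerivAt.fun_sum fun b _ => hasDerivAt_tiltZ (hp1 b) (hq0 b) ht.1
    have h2 := h1.sub ((hasDerivAt_id t).mul_const R)
    rw [one_mul] at h2
    exact h2
  obtain ⟨t, ht, hmax⟩ := exists_max_deriv_le_mul hd
  refine ⟨t, ht, fun t' ht' => ?_, exists_filter_of_max_le he hp hp1 hq hq1 hL hV ht hmax⟩
  have h := (convex_Icc (0 : ℝ) 1).image_sub_le_mul_sub_of_deriv_le
    (fun x hx => (hd x hx).continuousAt.continuousWithinAt)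
    (fun x hx => (hd x (interior_subset hx)).differentiableAt.differentiableWithinAt)
    (C := Fintype.card ι * L) (fun x hx => ?_) t' ⟨ht'.1, ht'.2.trans ht.2⟩ t ht ht'.2
  · linarith
  · rw [(hd x (interior_subset hx)).deriv, tiltExponentDeriv]
    have h1 := Finset.sum_le_sum fun b (_ : b ∈ Finset.univ) =>
      tiltMean_div_sub_log_le (hp1 b) (hq b) x
    rw [Finset.sum_const, Finset.card_univ, nsmul_eq_mul] at h1
    linarith

end

theorem trace_conj_diagonal {n : Type*} [Fintype n] [DecidableEq n] {U : Matrix n n ℂ}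
    (hU : U * Uᴴ = 1) (b : n → ℝ) :
    (U * diagonal (fun i => (b i : ℂ)) * Uᴴ).trace = ((∑ i, b i : ℝ) : ℂ) := by
  rw [mul_assoc, trace_mul_comm, mul_assoc, mul_eq_one_comm.mp hU, mul_one, trace_diagonal]
  push_cast
  rfl

section
variable {ι I : Type*} {C : ι → Type*} [Fintype ι] [Nonempty ι] [Fintype I] [DecidableEq I]
  [∀ b, Fintype (C b)] [∀ b, DecidableEq (C b)]
  {e : I → ∀ b, C b} {ρ σ : ∀ b, Matrix (C b) (C b) ℂ} {L R : ℝ}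

/-- Simulation of a product state using a product operator with controlled spectrum. -/
theorem exists_simulation_tens (he : Function.Bijective e) (hρ : ∀ b, IsDensity (ρ b))
    (hσ : ∀ b, IsDensity (σ b)) (hL : 0 ≤ L)
    (hσL : ∀ b, (σ b - Real.exp (-L) • (1 : Matrix (C b) (C b) ℂ)).PosSemidef) (hR : 0 ≤ R) :
    ∃ t ∈ Set.Icc (0 : ℝ) 1, ∃ w : Matrix I I ℂ, IsDensity w ∧
      (Real.exp R • tens e σ - w).PosSemidef ∧
      ∀ t' ∈ Set.Icc (0 : ℝ) t, (∀ b, 0 < sandQ (1 / (1 + t')) (ρ b) (σ b)) →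
        Real.exp (∑ b, (1 + t') * Real.log (sandQ (1 / (1 + t')) (ρ b) (σ b)) + t' * R
          - Fintype.card ι * (1 + (L + 1) * (t - t') + Real.log (L + 1))
          - 2 * √(2 * (Fintype.card ι * (4 * (L + 1) ^ 2 + 32)))) / 4 ≤ qFid (tens e ρ) w := by
  choose U q hU hqL hq1 hσq hpin hZ using fun b => exists_pinching_basis (hρ b) (hσ b) hL (hσL b)
  let p : ∀ b, C b → ℝ := fun b y => (((U b)ᴴ * ρ b * U b) y y).re
  have hTp : ∀ b, ((U b)ᴴ * ρ b * U b).PosSemidef := fun b =>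
    (hρ b).1.conjTranspose_mul_mul_same (U b)
  have hpc : ∀ b y, (p b y : ℂ) = ((U b)ᴴ * ρ b * U b) y y := fun b y =>
    (hTp b).1.coe_re_apply_self y
  have hp0 : ∀ b c, 0 ≤ p b c := fun b c => (Complex.le_def.mp (hTp b).diag_nonneg).1
  have hp1 : ∀ b, ∑ c, p b c = 1 := by
    intro b
    have h1 : ((U b)ᴴ * ρ b * U b).trace = 1 := by
      rw [trace_mul_comm, ← mul_assoc, hU, one_mul, (hρ b).2]
    have h2 : ((∑ c, p b c : ℝ) : ℂ) = 1 := by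
      rw [← h1, trace]
      push_cast
      exact Finset.sum_congr rfl fun c _ => hpc b c
    exact_mod_cast h2
  have hqs : ∀ b, ∑ c, q b c ≤ 1 := by
    intro b
    have h1 := trace_re_mono (hσq b)
    rw [trace_conj_diagonal (hU b), (hσ b).2, Complex.ofReal_re] at h1
    simpa using h1
  have hq0 : ∀ b c, 0 < q b c := fun b c => (Real.exp_pos _).trans_le (hqL b c)
  set V : ℝ := (L + 1) ^ Fintype.card ι with hV
  have hV1 : 1 ≤ V := one_le_pow₀ (by linarith)
  obtain ⟨t, ht, hS, a, ha, hsum, hle, hfid⟩ := exists_filter he hp0 hp1 hqL hqs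
    (by linarith : 0 ≤ L + 1) hR hV1
  have hUx := tens_unitary he hU
  have hpx : ∀ x, ∏ b, p b (e x b) =
      (((tens e U)ᴴ * tens e ρ * tens e U) x x).re := by
    intro x
    rw [tens_conjTranspose, tens_mul he, tens_mul he]
    simp only [tens, of_apply, ← hpc, ← Complex.ofReal_prod, Complex.ofReal_re]
  have hpinx : (V • (tens e U * diagonal (fun x => ((∏ b, p b (e x b) : ℝ) : ℂ)) * (tens e U)ᴴ)
      - tens e ρ).PosSemidef := by
    have h1 : ∀ b, (L + 1) • (U b * diagonal (fun i => ((p b i : ℝ) : ℂ)) * (U b)ᴴ) =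
        U b * diagonal (fun i => (((L + 1) * p b i : ℝ) : ℂ)) * (U b)ᴴ := by
      intro b
      have := conj_diagonal_sub (U := U b) (fun _ => 0) (p b) (-(L + 1))
      simp only [Complex.ofReal_zero, diagonal_zero, mul_zero, zero_mul, neg_smul, zero_sub,
        neg_neg, neg_mul] at this
      exact this
    have h2 := tens_mono he (fun b => (hρ b).1)
      (fun b => posSemidef_real_smul (conj_diagonal_posSemidef (U := U b) (hp0 b))
        (by linarith : 0 ≤ L + 1)) hpin
    simp only [h1] at h2
    rw [tens_conj_diagonal he] at h2
    convert h2 using 2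
    have := conj_diagonal_sub (U := tens e U) (fun _ => 0) (fun x => ∏ b, p b (e x b)) (-V)
    simp only [Complex.ofReal_zero, diagonal_zero, mul_zero, zero_mul, neg_smul, zero_sub,
      neg_neg, neg_mul] at this
    rw [this]
    simp only [Finset.prod_mul_distrib, Finset.prod_const, Finset.card_univ, hV]
  have hqx : (tens e σ - tens e U * diagonal (fun x => ((∏ b, q b (e x b) : ℝ) : ℂ)) *
      (tens e U)ᴴ).PosSemidef := by
    rw [← tens_conj_diagonal he]
    exact tens_mono he (fun b => conj_diagonal_posSemidef fun c => (hq0 b c).le)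
      (fun b => (hσ b).1) hσq
  obtain ⟨w, hw, hwσ, hwF⟩ := exists_filtered_state (tens_isDensity he hρ) (tens_isDensity he hσ)
    hUx hpx hpinx hqx (Real.one_le_exp hR) ha hle hsum
  refine ⟨t, ht, w, hw, hwσ, fun t' ht' hpos => ?_⟩
  refine le_trans ?_ (hfid.trans hwF)
  refine div_le_div_of_nonneg_right (Real.exp_le_exp.mpr ?_) (by norm_num)
  have ht1 : 0 < 1 + t' := by linarith [ht'.1]
  have hα1 : 1 / (1 + t') ≤ 1 := by
    rw [div_le_one ht1]
    linarith [ht'.1]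
  have hα : 1 / 2 ≤ 1 / (1 + t') :=
    one_div_le_one_div_of_le ht1 (by linarith [ht'.2, ht.2])
  have hSt' : tiltExponent p q R t' ≤ Fintype.card ι -
      ∑ b, (1 + t') * Real.log (sandQ (1 / (1 + t')) (ρ b) (σ b)) - t' * R := by
    have h1 : ∀ b, -(1 + t') * Real.log (tiltZ (p b) (q b) t') ≤
        1 - (1 + t') * Real.log (sandQ (1 / (1 + t')) (ρ b) (σ b)) := by
      intro b
      have h2 := hZ b _ hα hα1
      have h3 : tiltZ (p b) (q b) t' =
          ∑ y, p b y ^ (1 / (1 + t')) * q b y ^ (1 - 1 / (1 + t')) :=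
        Finset.sum_congr rfl fun c _ => tilt_eq_rpow (hp0 b) (hq0 b) ht'.1 c
      have h4 := Real.log_le_log (mul_pos (Real.exp_pos _) (hpos b)) (h2.trans_eq h3.symm)
      rw [Real.log_mul (Real.exp_pos _).ne' (hpos b).ne', Real.log_exp] at h4
      have h5 := mul_le_mul_of_nonneg_left h4 ht1.le
      have h6 : (1 + t') * (-(1 - 1 / (1 + t'))) = -t' := by
        field_simp
        ring
      have h7 : t' ≤ 1 := ht'.2.trans ht.2
      rw [mul_add, h6] at h5
      linarith
    have h2 := Finset.sum_le_sum fun b (_ : b ∈ Finset.univ) => h1 b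
    rw [Finset.sum_sub_distrib, Finset.sum_const, Finset.card_univ, nsmul_one] at h2
    rw [tiltExponent]
    linarith
  have h1 := hS t' ht'
  rw [hV, Real.log_pow]
  nlinarith

end

section
variable {n : Type*} [Fintype n] [DecidableEq n]

theorem IsDensity.ne_zero {ρ : Matrix n n ℂ} (h : IsDensity ρ) : ρ ≠ 0 := by
  rintro rfl
  simpa using h.2

theorem IsDensity.card_pos {ρ : Matrix n n ℂ} (h : IsDensity ρ) : 0 < Fintype.card n := by
  by_contra hc
  have : IsEmpty n := Fintype.card_eq_zero_iff.mp (by omega)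
  exact h.ne_zero (Subsingleton.elim _ _)

/-- The maximally mixed state. -/
def mixedState (n : Type*) [Fintype n] [DecidableEq n] : Matrix n n ℂ :=
  ((Fintype.card n : ℝ)⁻¹) • 1

theorem isDensity_mixedState (h : 0 < Fintype.card n) : IsDensity (mixedState n) := by
  refine ⟨posSemidef_real_smul PosSemidef.one (by positivity), ?_⟩
  have : (Fintype.card n : ℂ) ≠ 0 := by exact_mod_cast h.ne'
  rw [mixedState, trace_smul, trace_one, Complex.real_smul]
  push_cast
  exact inv_mul_cancel₀ this

theorem card_rpow_le_sandQ {α : ℝ} (hα : 1 / 2 ≤ α) (hα1 : α ≤ 1) {ρ : Matrix n n ℂ}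
    (hρ : IsDensity ρ) : ((Fintype.card n : ℝ)⁻¹) ^ (1 - α) ≤ sandQ α ρ (mixedState n) := by
  have h1 := sandQ_mono hα hα1 hρ.1 PosSemidef.one (isDensity_mixedState hρ.card_pos).1
    (c := (Fintype.card n : ℝ)⁻¹) (by positivity) (by
      rw [mixedState, sub_self]; exact PosSemidef.zero)
  refine le_trans ?_ h1
  rw [sandQ_one_right]
  have h2 := one_le_trace_rpow hρ (s := α) (by linarith) hα1
  exact le_mul_of_one_le_right (by positivity) h2

theorem sandD_of_lt_one {α : ℝ} (hα1 : α < 1) (ρ σ : Matrix n n ℂ) :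
    sandD α ρ σ = if ρ * σ = 0 then (⊤ : EReal)
      else (((α - 1)⁻¹ * Real.log (sandQ α ρ σ) : ℝ) : EReal) := by
  rw [sandD, if_neg hα1.ne]
  simp only [not_lt.mpr hα1.le, hα1, false_and, true_and, false_or]
  rfl

theorem sandD_mixedState_le {α : ℝ} (hα : 1 / 2 ≤ α) (hα1 : α < 1) {ρ : Matrix n n ℂ}
    (hρ : IsDensity ρ) :
    sandD α ρ (mixedState n) ≤ ((Real.log (Fintype.card n) : ℝ) : EReal) := by
  have hd : (0 : ℝ) < Fintype.card n := by exact_mod_cast hρ.card_pos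
  have h0 : ρ * mixedState n ≠ 0 := by
    rw [mixedState, Matrix.mul_smul, mul_one]
    exact smul_ne_zero (by positivity) hρ.ne_zero
  rw [sandD_of_lt_one hα1, if_neg h0, EReal.coe_le_coe_iff]
  have h1 := Real.log_le_log (by positivity) (card_rpow_le_sandQ hα hα1.le hρ)
  rw [Real.log_rpow (by positivity), Real.log_inv] at h1
  rw [← div_eq_inv_mul, div_le_iff_of_neg (by linarith)]
  linarith

theorem le_sandD {α : ℝ} (hα : 1 / 2 ≤ α) (hα1 : α < 1) {ρ σ : Matrix n n ℂ}
    (hρ : IsDensity ρ) (hσ : IsDensity σ) :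
    (((α - 1)⁻¹ * Real.log (Fintype.card n) : ℝ) : EReal) ≤ sandD α ρ σ := by
  rw [sandD_of_lt_one hα1]
  split_ifs with h
  · exact le_top
  · rw [EReal.coe_le_coe_iff]
    exact mul_le_mul_of_nonpos_left (Real.log_le_log (sandQ_pos hα hα1.le hρ.1 hσ.1 h)
      (sandQ_le_card hα hα1.le hρ hσ)) (inv_nonpos.mpr (by linarith))

end

section
variable {X B : Type*} [Fintype X] [Nonempty X] [Fintype B] [DecidableEq B]
  {W : X → Matrix B B ℂ}

theorem exists_sandMI_eq (hW : ∀ x, IsDensity (W x)) {α : ℝ} (hα : 1 / 2 ≤ α) (hα1 : α < 1) :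
    ∃ v : ℝ, sandMI α W = (v : EReal) ∧ v ≤ Real.log (Fintype.card B) := by
  obtain ⟨x0⟩ := ‹Nonempty X›
  have hup : sandMI α W ≤ ((Real.log (Fintype.card B) : ℝ) : EReal) :=
    (iInf_le (fun σ : {σ : Matrix B B ℂ // IsDensity σ} => ⨆ x, sandD α (W x) σ.1)
      ⟨mixedState B, isDensity_mixedState (hW x0).card_pos⟩).trans
        (iSup_le fun x => sandD_mixedState_le hα hα1 (hW x))
  have hlo : (((α - 1)⁻¹ * Real.log (Fintype.card B) : ℝ) : EReal) ≤ sandMI α W :=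
    le_iInf fun σ => (le_sandD hα hα1 (hW x0) σ.2).trans (le_iSup (fun x => sandD α (W x) σ.1) x0)
  have h1 : sandMI α W ≠ ⊤ := (hup.trans_lt (EReal.coe_lt_top _)).ne
  have h2 : sandMI α W ≠ ⊥ := ((EReal.bot_lt_coe _).trans_le hlo).ne'
  refine ⟨(sandMI α W).toReal, (EReal.coe_toReal h1 h2).symm, ?_⟩
  rw [← EReal.coe_le_coe_iff, EReal.coe_toReal h1 h2]
  exact hup

theorem exists_near_optimal (hW : ∀ x, IsDensity (W x)) {t : ℝ} (ht : 0 < t) (ht1 : t ≤ 1)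
    {ε : ℝ} (hε : 0 < ε) :
    ∃ σ : Matrix B B ℂ, IsDensity σ ∧ ∀ x, 0 < sandQ (1 / (1 + t)) (W x) σ ∧
      -(t * ((sandMI (1 / (1 + t)) W).toReal + ε)) ≤
        (1 + t) * Real.log (sandQ (1 / (1 + t)) (W x) σ) := by
  have h1t : 0 < 1 + t := by linarith
  have hα1 : 1 / (1 + t) < 1 := by
    rw [div_lt_one h1t]
    linarith
  have hα : 1 / 2 ≤ 1 / (1 + t) := one_div_le_one_div_of_le h1t (by linarith)
  obtain ⟨v, hv, -⟩ := exists_sandMI_eq hW hα hα1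
  have h1 : sandMI (1 / (1 + t)) W < ((v + ε : ℝ) : EReal) := by
    rw [hv, EReal.coe_lt_coe_iff]
    linarith
  obtain ⟨σ, hσ⟩ := iInf_lt_iff.mp h1
  refine ⟨σ.1, σ.2, fun x => ?_⟩
  have h2 := (le_iSup (fun x => sandD (1 / (1 + t)) (W x) σ.1) x).trans_lt hσ
  simp only [sandD_of_lt_one hα1] at h2
  split_ifs at h2 with h3
  · exact absurd h2 not_top_lt
  · refine ⟨sandQ_pos hα hα1.le (hW x).1 σ.2.1 h3, ?_⟩
    rw [EReal.coe_lt_coe_iff, ← div_eq_inv_mul, div_lt_iff_of_neg' (by linarith)] at h2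
    rw [hv, EReal.toReal_coe]
    have h4 := mul_lt_mul_of_pos_left h2 h1t
    have h5 : (1 + t) * ((1 / (1 + t) - 1) * (v + ε)) = -(t * (v + ε)) := by
      field_simp
      ring
    linarith

end

section
variable {J n : Type*} [Fintype J] [Nonempty J] [Fintype n] [DecidableEq n]

theorem isDensity_average {T : J → Matrix n n ℂ} (hT : ∀ j, IsDensity (T j)) :
    IsDensity (((Fintype.card J : ℝ)⁻¹) • ∑ j, T j) := by
  refine ⟨posSemidef_real_smul (posSemidef_sum _ fun j _ => (hT j).1) (by positivity), ?_⟩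
  have : (Fintype.card J : ℂ) ≠ 0 := by exact_mod_cast Fintype.card_ne_zero
  rw [trace_smul, trace_sum]
  simp only [(hT _).2, Finset.sum_const, Finset.card_univ, nsmul_eq_mul, mul_one,
    Complex.real_smul]
  push_cast
  exact inv_mul_cancel₀ this

theorem average_sub_posSemidef {T : J → Matrix n n ℂ} (hT : ∀ j, IsDensity (T j)) (j : J) :
    (((Fintype.card J : ℝ)⁻¹) • ∑ j, T j - ((Fintype.card J : ℝ)⁻¹) • T j).PosSemidef := by
  rw [← smul_sub]
  refine posSemidef_real_smul ?_ (by positivity)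
  rw [← Finset.add_sum_erase _ _ (Finset.mem_univ j), add_sub_cancel_left]
  exact posSemidef_sum _ fun j _ => (hT j).1

end

theorem tens_id_mixedState {F B : Type*} [Fintype F] [DecidableEq F] [Fintype B] [DecidableEq B] :
    tens (id : (F → B) → F → B) (fun _ => mixedState B) =
      ((Fintype.card B : ℝ)⁻¹ ^ Fintype.card F) • 1 := by
  ext x y
  simp only [tens, of_apply, id, mixedState, Matrix.smul_apply, Finset.prod_const,
    Complex.real_smul, Finset.prod_mul_distrib, Finset.card_univ]
  have h : ∏ i, (1 : Matrix B B ℂ) (x i) (y i) = (1 : Matrix (F → B) (F → B) ℂ) x y := by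
    by_cases hxy : x = y
    · subst hxy
      simp
    · obtain ⟨i, hi⟩ := Function.ne_iff.mp hxy
      rw [one_apply_ne hxy]
      exact Finset.prod_eq_zero (Finset.mem_univ i) (one_apply_ne hi)
  rw [h]
  push_cast
  rfl

/-- Grouping the coordinates of a word according to the fibers of a map. -/
def fiberMap {A B ι : Type*} (blk : A → ι) (y : A → B) (b : ι) (i : {i // blk i = b}) : B := y i.1

theorem fiberMap_bijective {A B ι : Type*} (blk : A → ι) :
    Function.Bijective (fiberMap (B := B) blk) := by
  constructor
  · intro y z h
    funext i
    exact congrFun (congrFun h (blk i)) ⟨i, rfl⟩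
  · intro g
    refine ⟨fun i => g (blk i) ⟨i, rfl⟩, ?_⟩
    funext b ⟨i, hi⟩
    subst hi
    rfl

theorem cqPow_eq_tens {X : Type*} {d : ℕ} {W : X → Matrix (Fin d) (Fin d) ℂ} {k n : ℕ}
    (blk : Fin n → Fin k) (xs : Fin n → X) :
    cqPow W n xs = tens (fiberMap blk) fun b =>
      tens id fun i : {i // blk i = b} => W (xs i.1) := by
  ext x y
  simp only [cqPow, tens, of_apply, id, fiberMap]
  exact (Fintype.prod_fiberwise blk fun i => W (xs i) (x i) (y i)).symm

/-- The uniform mixture of the tensor powers of the states `τ j`. -/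
def powerMixture (N F : Type*) [Fintype N] [Fintype F] {d : ℕ} (τ : N → Matrix (Fin d) (Fin d) ℂ) :
    Matrix (F → Fin d) (F → Fin d) ℂ :=
  ((Fintype.card N : ℝ)⁻¹) • ∑ j, tens id fun _ : F => τ j

section
variable {F : Type*} [Fintype F] [DecidableEq F] {d n : ℕ} {τ : Fin (n + 1) → Matrix (Fin d) (Fin d) ℂ}

theorem isDensity_powerMixture (hτ : ∀ j, IsDensity (τ j)) :
    IsDensity (powerMixture (Fin (n + 1)) F τ) :=
  isDensity_average fun j => tens_isDensity Function.bijective_id fun _ => hτ j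

theorem inv_card_fin_succ (n : ℕ) :
    ((Fintype.card (Fin (n + 1)) : ℝ)⁻¹) = Real.exp (-Real.log (n + 1)) := by
  rw [Real.exp_neg, Real.exp_log (by positivity), Fintype.card_fin]
  push_cast
  rfl

theorem powerMixture_sub_posSemidef (hd : 0 < d) (hτ : ∀ j, IsDensity (τ j))
    (hτ0 : τ 0 = mixedState (Fin d)) {m : ℕ} (hF : Fintype.card F ≤ m) {L : ℝ}
    (hL : L = m * Real.log d + Real.log (n + 1)) :
    (powerMixture (Fin (n + 1)) F τ - Real.exp (-L) • 1).PosSemidef := by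
  have hlogd : 0 ≤ Real.log d := Real.log_nonneg (by exact_mod_cast hd)
  have h1 := average_sub_posSemidef
    (fun j => tens_isDensity Function.bijective_id fun _ : F => hτ j) 0
  rw [hτ0, tens_id_mixedState, Fintype.card_fin d, smul_smul] at h1
  have h3 : Real.exp (-L) ≤ (Fintype.card (Fin (n + 1)) : ℝ)⁻¹ *
      (d : ℝ)⁻¹ ^ Fintype.card F := by
    have h4 : (d : ℝ)⁻¹ = Real.exp (-Real.log d) := by
      rw [Real.exp_neg, Real.exp_log (by exact_mod_cast hd)]
    rw [inv_card_fin_succ, h4, ← Real.exp_nat_mul, ← Real.exp_add]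
    refine Real.exp_le_exp.mpr ?_
    have h5 : (Fintype.card F : ℝ) * Real.log d ≤ m * Real.log d :=
      mul_le_mul_of_nonneg_right (by exact_mod_cast hF) hlogd
    rw [hL]
    linarith
  have h6 := h1.add (posSemidef_real_smul PosSemidef.one (sub_nonneg.mpr h3))
  rw [sub_smul] at h6
  convert h6 using 1
  rw [powerMixture]
  abel

theorem log_sandQ_powerMixture {X : Type*} {W : X → Matrix (Fin d) (Fin d) ℂ}
    (hW : ∀ x, IsDensity (W x)) (hτ : ∀ j, IsDensity (τ j)) (j : Fin (n + 1)) {t : ℝ}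
    (ht : 0 ≤ t) (ht1 : t ≤ 1) (hQ : ∀ x, 0 < sandQ (1 / (1 + t)) (W x) (τ j)) (xs : F → X) :
    0 < sandQ (1 / (1 + t)) (tens id fun i => W (xs i)) (powerMixture (Fin (n + 1)) F τ) ∧
    -Real.log (n + 1) + ∑ i, (1 + t) * Real.log (sandQ (1 / (1 + t)) (W (xs i)) (τ j)) ≤
      (1 + t) * Real.log (sandQ (1 / (1 + t)) (tens id fun i => W (xs i))
        (powerMixture (Fin (n + 1)) F τ)) := by
  have hlogn : 0 ≤ Real.log ((n : ℝ) + 1) :=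
    Real.log_nonneg (by linarith [(Nat.cast_nonneg n : (0 : ℝ) ≤ n)])
  have h1t : 0 < 1 + t := by linarith
  set α := 1 / (1 + t) with hα
  have hα1 : α ≤ 1 := by
    rw [hα, div_le_one h1t]
    linarith
  have hα2 : 1 / 2 ≤ α := one_div_le_one_div_of_le h1t (by linarith)
  have hαt : (1 + t) * (1 - α) = t := by
    rw [hα]
    field_simp
    ring
  have hT : sandQ α (tens id fun i => W (xs i)) (tens id fun _ : F => τ j) =
      ∏ i, sandQ α (W (xs i)) (τ j) :=
    sandQ_tens Function.bijective_id (fun i => (hW (xs i)).1) (fun _ => (hτ j).1) α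
  have hTpos : 0 < sandQ α (tens id fun i => W (xs i)) (tens id fun _ : F => τ j) := by
    rw [hT]
    exact Finset.prod_pos fun i _ => hQ _
  have hσQ : Real.exp (-Real.log (n + 1)) ^ (1 - α) *
      sandQ α (tens id fun i => W (xs i)) (tens id fun _ : F => τ j) ≤
      sandQ α (tens id fun i => W (xs i)) (powerMixture (Fin (n + 1)) F τ) := by
    rw [← inv_card_fin_succ]
    exact sandQ_mono hα2 hα1 (tens_isDensity Function.bijective_id fun i => hW (xs i)).1
      (tens_isDensity Function.bijective_id fun _ => hτ j).1 (isDensity_powerMixture hτ).1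
      (by positivity)
      (average_sub_posSemidef (fun j => tens_isDensity Function.bijective_id fun _ : F => hτ j) j)
  refine ⟨(mul_pos (Real.rpow_pos_of_pos (Real.exp_pos _) _) hTpos).trans_le hσQ, ?_⟩
  have h1 := Real.log_le_log (mul_pos (Real.rpow_pos_of_pos (Real.exp_pos _) _) hTpos) hσQ
  rw [Real.log_mul (Real.rpow_pos_of_pos (Real.exp_pos _) _).ne' hTpos.ne',
    Real.log_rpow (Real.exp_pos _), Real.log_exp, hT,
    Real.log_prod (fun i _ => (hQ _).ne')] at h1
  have h2 := mul_le_mul_of_nonneg_left h1 h1t.le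
  rw [mul_add, ← mul_assoc, hαt] at h2
  rw [← Finset.mul_sum]
  have h3 : t * Real.log (n + 1) ≤ 1 * Real.log (n + 1) :=
    mul_le_mul_of_nonneg_right ht1 hlogn
  linarith

end

section
variable {X : Type*} [Fintype X] [Nonempty X] {d : ℕ} {W : X → Matrix (Fin d) (Fin d) ℂ}

theorem exists_grid_states (hW : ∀ x, IsDensity (W x)) {n : ℕ} (hn : 1 ≤ n) (j : Fin (n + 1)) :
    ∃ τ : Matrix (Fin d) (Fin d) ℂ, IsDensity τ ∧
      ((j : ℕ) = 0 → τ = mixedState (Fin d)) ∧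
      ∀ x, 0 < sandQ (1 / (1 + (j : ℕ) / (n : ℝ))) (W x) τ ∧
      -((j : ℕ) / (n : ℝ) * ((sandMI (1 / (1 + (j : ℕ) / (n : ℝ))) W).toReal + 1 / n)) ≤
        (1 + (j : ℕ) / (n : ℝ)) * Real.log (sandQ (1 / (1 + (j : ℕ) / (n : ℝ))) (W x) τ) := by
  have hn0 : (0 : ℝ) < n := by exact_mod_cast hn
  obtain ⟨x0⟩ := ‹Nonempty X›
  have hd : 0 < d := by simpa using (hW x0).card_pos
  by_cases hj : (j : ℕ) = 0
  · refine ⟨mixedState (Fin d), isDensity_mixedState (by simpa using hd), fun _ => rfl,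
      fun x => ?_⟩
    have h1 := card_rpow_le_sandQ (α := 1) (by norm_num) le_rfl (hW x)
    rw [sub_self, Real.rpow_zero] at h1
    simp only [hj, Nat.cast_zero, zero_div, add_zero, div_one, zero_mul, neg_zero, one_mul]
    exact ⟨by linarith, Real.log_nonneg h1⟩
  · have hj0 : (0 : ℝ) < (j : ℕ) := by exact_mod_cast Nat.pos_of_ne_zero hj
    have hjn : ((j : ℕ) : ℝ) ≤ n := by exact_mod_cast Nat.lt_succ_iff.mp j.2
    obtain ⟨τ, hτ, h⟩ := exists_near_optimal hW (t := (j : ℕ) / (n : ℝ)) (by positivity)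
      ((div_le_one hn0).mpr hjn) (ε := 1 / n) (by positivity)
    exact ⟨τ, hτ, fun h0 => absurd h0 hj, h⟩

/-- Simulation of a product channel in terms of blocks of length at most `m`. -/
theorem exists_simulation_cqPow (hW : ∀ x, IsDensity (W x)) {r : ℝ} (hr : 0 ≤ r) {n m k : ℕ}
    [NeZero k] (hn : 1 ≤ n) (blk : Fin n → Fin k)
    (hblk : ∀ b, Fintype.card {i // blk i = b} ≤ m) {L : ℝ}
    (hLdef : L = m * Real.log d + Real.log (n + 1)) :
    ∃ σ : Matrix (Fin n → Fin d) (Fin n → Fin d) ℂ, IsDensity σ ∧ ∀ xs, ∃ w, IsDensity w ∧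
      (Real.exp (n * r) • σ - w).PosSemidef ∧ ∃ α : ℝ, 1 / 2 ≤ α ∧ α ≤ 1 ∧
      Real.exp (-(n : ℝ) * ((1 - α) / α) * ((sandMI α W).toReal - r) - 1 -
        k * (1 + Real.log (n + 1) + (L + 1) / n + Real.log (L + 1)) -
        2 * √(2 * (k * (4 * (L + 1) ^ 2 + 32)))) / 4 ≤ qFid (cqPow W n xs) w := by
  have hn0 : (0 : ℝ) < n := by exact_mod_cast hn
  obtain ⟨x0⟩ := ‹Nonempty X›
  have hd : 0 < d := by simpa using (hW x0).card_pos
  have hlogd : 0 ≤ Real.log d := Real.log_nonneg (by exact_mod_cast hd)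
  have hlogn : 0 ≤ Real.log (n + 1) := Real.log_nonneg (by linarith)
  have hL : 0 ≤ L := by rw [hLdef]; positivity
  have hgrid := exists_grid_states hW hn
  choose τ hτ hτ0 hτQ using hgrid
  refine ⟨tens (fiberMap blk) fun b => powerMixture (Fin (n + 1)) {i // blk i = b} τ,
    tens_isDensity (fiberMap_bijective blk) fun _ => isDensity_powerMixture hτ, fun xs => ?_⟩
  have hρ : ∀ b, IsDensity (tens id fun i : {i // blk i = b} => W (xs i.1)) := fun b =>
    tens_isDensity Function.bijective_id fun i => hW (xs i.1)
  have : Nonempty (Fin k) := ⟨0⟩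
  obtain ⟨t, ht, w, hw, hwσ, hF⟩ := exists_simulation_tens (fiberMap_bijective blk) hρ
    (fun b => isDensity_powerMixture (F := {i // blk i = b}) hτ) hL
    (fun b => powerMixture_sub_posSemidef hd hτ (hτ0 0 rfl) (hblk b) hLdef) (mul_nonneg hn0.le hr)
  refine ⟨w, hw, hwσ, ?_⟩
  have htn : 0 ≤ t * n := mul_nonneg ht.1 hn0.le
  let j : Fin (n + 1) := ⟨⌊t * n⌋₊, Nat.lt_succ_of_le (Nat.floor_le_of_le (by nlinarith [ht.2]))⟩
  set t' : ℝ := (j : ℕ) / (n : ℝ) with ht'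
  have ht'0 : 0 ≤ t' := by positivity
  have ht't : t' ≤ t := by
    rw [ht', div_le_iff₀ hn0]
    exact Nat.floor_le htn
  have htt' : t - t' ≤ 1 / n := by
    have h1 := Nat.lt_floor_add_one (t * n)
    rw [ht', le_div_iff₀ hn0, sub_mul, div_mul_cancel₀ _ hn0.ne']
    simp only [j]
    linarith
  have ht'1 : t' ≤ 1 := ht't.trans ht.2
  have h1t : 0 < 1 + t' := by linarith
  set α := 1 / (1 + t') with hα
  have hα1 : α ≤ 1 := by
    rw [hα, div_le_one h1t]
    linarith
  have hα2 : 1 / 2 ≤ α := one_div_le_one_div_of_le h1t (by linarith)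
  have hQ := hτQ j
  have hmix := fun b => log_sandQ_powerMixture (F := {i // blk i = b}) hW hτ j ht'0 ht'1
    (fun x => (hQ x).1) fun i => xs i.1
  have hsum := Finset.sum_le_sum fun b (_ : b ∈ Finset.univ) => (hmix b).2
  rw [Finset.sum_add_distrib, Fintype.sum_fiberwise blk
    (fun i => (1 + t') * Real.log (sandQ α (W (xs i)) (τ j))), Finset.sum_const, Finset.card_univ,
    Fintype.card_fin, nsmul_eq_mul] at hsum
  have hsum2 := Finset.sum_le_sum fun i (_ : i ∈ Finset.univ) => (hQ (xs i)).2
  rw [Finset.sum_const, Finset.card_univ, Fintype.card_fin, nsmul_eq_mul] at hsum2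
  have hFj := hF t' ⟨ht'0, ht't⟩ fun b => (hmix b).1
  rw [← cqPow_eq_tens] at hFj
  refine ⟨α, hα2, hα1, le_trans ?_ hFj⟩
  refine div_le_div_of_nonneg_right (Real.exp_le_exp.mpr ?_) (by norm_num)
  rw [Fintype.card_fin]
  have hk : (0 : ℝ) ≤ k := Nat.cast_nonneg k
  have h1 : (1 - α) / α = t' := by
    rw [hα]
    field_simp
    ring
  rw [h1]
  have h2 : (k : ℝ) * ((L + 1) * (t - t')) ≤ k * ((L + 1) / n) := by
    refine mul_le_mul_of_nonneg_left ?_ hk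
    rw [div_eq_mul_one_div]
    exact mul_le_mul_of_nonneg_left htt' (by linarith)
  have h3 : (n : ℝ) * (t' * (1 / n)) ≤ 1 := by
    rw [mul_left_comm, mul_one_div_cancel hn0.ne']
    linarith
  have h4 : (n : ℝ) * -(t' * ((sandMI α W).toReal + 1 / n)) =
      -(n * t' * (sandMI α W).toReal) - n * (t' * (1 / n)) := by ring
  change (n : ℝ) * -(t' * ((sandMI α W).toReal + 1 / n)) ≤ _ at hsum2
  rw [h4] at hsum2
  have hsum3 := (add_le_add_right hsum2 ((k : ℝ) * -Real.log (n + 1))).trans hsum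
  linarith

end

section
variable {X B : Type*} [Fintype X] [Fintype B] [DecidableEq B]

theorem qEpsNS_nonneg (W : X → Matrix B B ℂ) (M : ℝ) : 0 ≤ qEpsNS W M := by
  refine Real.sInf_nonneg ?_
  rintro e ⟨W', σ, -, -, -, rfl⟩
  exact Real.iSup_nonneg fun x => Real.sqrt_nonneg _

theorem half_le_one_sub_qEpsNS [Nonempty X] {W : X → Matrix B B ℂ} {M F : ℝ} {σ : Matrix B B ℂ}
    (hσ : IsDensity σ) (hF0 : 0 ≤ F)
    (h : ∀ x, ∃ w, IsDensity w ∧ (M • σ - w).PosSemidef ∧ F ≤ qFid (W x) w) :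
    1 / 2 * min F 1 ≤ 1 - qEpsNS W M := by
  choose w hw hwσ hwF using h
  have h1 : qEpsNS W M ≤ ⨆ x, qPD (W x) (w x) := by
    refine csInf_le ⟨0, ?_⟩ ⟨w, σ, hw, hσ, hwσ, rfl⟩
    rintro e ⟨W', σ, -, -, -, rfl⟩
    exact Real.iSup_nonneg fun x => Real.sqrt_nonneg _
  have h2 : ⨆ x, qPD (W x) (w x) ≤ 1 - 1 / 2 * min F 1 := by
    refine ciSup_le fun x => ?_
    have h3 : min F 1 ≤ qFid (W x) (w x) := (min_le_left _ _).trans (hwF x)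
    have h4 : min F 1 ≤ 1 := min_le_right _ _
    have h5 : 0 ≤ min F 1 := le_min hF0 zero_le_one
    rw [qPD, Real.sqrt_le_left (by linarith)]
    nlinarith
  linarith

end

theorem inv_card_le_qFid_mixedState {n : Type*} [Fintype n] [DecidableEq n] {ρ : Matrix n n ℂ}
    (hρ : IsDensity ρ) : (Fintype.card n : ℝ)⁻¹ ≤ qFid ρ (mixedState n) := by
  have hd : (0 : ℝ) ≤ (Fintype.card n : ℝ)⁻¹ := by positivity
  rw [qFid, mixedState, Matrix.mul_smul, Matrix.mul_one, Matrix.smul_mul, matFun_sqrt ρ,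
    matFun_half_mul_self hρ.1, matFun_sqrt, matFun_smul_rpow hρ.1 hd, trace_smul, Complex.smul_re,
    smul_eq_mul, mul_pow, ← Real.sqrt_eq_rpow, Real.sq_sqrt hd]
  exact le_mul_of_one_le_right hd
    (one_le_pow₀ (one_le_trace_rpow hρ (by norm_num) (by norm_num)))

theorem cqPow_isDensity {X : Type*} {d : ℕ} {W : X → Matrix (Fin d) (Fin d) ℂ}
    (hW : ∀ x, IsDensity (W x)) {n : ℕ} (xs : Fin n → X) : IsDensity (cqPow W n xs) :=
  tens_isDensity Function.bijective_id fun i => hW (xs i)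

/-- The position of `i` among consecutive blocks of length `m`. -/
def blockIndex (n m : ℕ) (i : Fin n) : Fin (n / m + 1) :=
  ⟨i / m, Nat.lt_succ_of_le (Nat.div_le_div_right i.2.le)⟩

theorem card_blockIndex_le {n m : ℕ} (hm : 0 < m) (b : Fin (n / m + 1)) :
    Fintype.card {i // blockIndex n m i = b} ≤ m := by
  refine (Fintype.card_le_of_injective
    (fun i : {i // blockIndex n m i = b} => (⟨i.1 % m, Nat.mod_lt _ hm⟩ : Fin m)) ?_).trans_eq
      (Fintype.card_fin m)
  rintro ⟨i, hi⟩ ⟨j, hj⟩ h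
  have h1 : (i : ℕ) % m = j % m := congrArg Fin.val h
  have h2 : (i : ℕ) / m = j / m := congrArg Fin.val (hi.trans hj.symm)
  refine Subtype.ext (Fin.ext ?_)
  change (i : ℕ) = j
  rw [← Nat.div_add_mod (i : ℕ) m, ← Nat.div_add_mod (j : ℕ) m, h1, h2]

theorem block_error_le {s ℓ k L : ℝ} (hs : 64 ≤ s) (hℓ : 1 ≤ ℓ) (hk : k ≤ 2 * s ^ 3) (hk0 : 0 ≤ k)
    (hL0 : 0 ≤ L) (hL : L + 1 ≤ 3 * s ^ 2 * ℓ) {v : ℝ} (hv : v ≤ ℓ) (hsv : Real.log (s ^ 5) ≤ v) :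
    1 + k * (1 + v + (L + 1) / s ^ 5 + Real.log (L + 1)) +
      2 * √(2 * (k * (4 * (L + 1) ^ 2 + 32))) + 2 ≤ 32 * s ^ 4 * ℓ := by
  have hs0 : 0 < s := by linarith
  have h5 : 3 * s ^ 2 ≤ s ^ 5 := by
    have : s ^ 2 * 3 ≤ s ^ 2 * s ^ 3 := by
      refine mul_le_mul_of_nonneg_left ?_ (by positivity)
      have := pow_le_pow_left₀ (by norm_num) hs 3
      linarith
    nlinarith
  have hL5 : L + 1 ≤ s ^ 5 * ℓ := hL.trans (mul_le_mul_of_nonneg_right h5 (by linarith))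
  have h1 : (L + 1) / s ^ 5 ≤ ℓ := by
    rw [div_le_iff₀ (by positivity)]
    linarith
  have h2 : Real.log (L + 1) ≤ 2 * ℓ := by
    have h3 := Real.log_le_log (by linarith) hL5
    rw [Real.log_mul (by positivity) (by linarith)] at h3
    have h4 := Real.log_le_sub_one_of_pos (show 0 < ℓ by linarith)
    linarith
  have h6 : k * (1 + v + (L + 1) / s ^ 5 + Real.log (L + 1)) ≤ 2 * s ^ 3 * (5 * ℓ) :=
    (mul_le_mul_of_nonneg_left (by linarith) hk0).trans
      (mul_le_mul_of_nonneg_right hk (by linarith))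
  have h7 : √(2 * (k * (4 * (L + 1) ^ 2 + 32))) ≤ 2 * s ^ 4 * ℓ := by
    refine Real.sqrt_le_iff.mpr ⟨by positivity, ?_⟩
    have h8 : (L + 1) ^ 2 ≤ (3 * s ^ 2 * ℓ) ^ 2 := pow_le_pow_left₀ (by linarith) hL 2
    have h9 : 1 ≤ s ^ 4 * ℓ ^ 2 := one_le_mul_of_one_le_of_one_le
      (one_le_pow₀ (by linarith)) (one_le_pow₀ hℓ)
    have h10 : 4 * (L + 1) ^ 2 + 32 ≤ 68 * (s ^ 4 * ℓ ^ 2) - 4 := by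
      nlinarith
    have h11 : 4 * (L + 1) ^ 2 + 32 ≤ 64 * (s ^ 4 * ℓ ^ 2) := by
      have h12 : (64 : ℝ) ^ 4 ≤ s ^ 4 := pow_le_pow_left₀ (by norm_num) hs 4
      have h13 : s ^ 4 * 1 ≤ s ^ 4 * ℓ ^ 2 :=
        mul_le_mul_of_nonneg_left (one_le_pow₀ hℓ) (by positivity)
      nlinarith
    have h14 : k * (4 * (L + 1) ^ 2 + 32) ≤ 2 * s ^ 3 * (64 * (s ^ 4 * ℓ ^ 2)) :=
      mul_le_mul hk h11 (by positivity) (by positivity)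
    have h15 : 64 * (s ^ 7 * ℓ ^ 2) ≤ s * (s ^ 7 * ℓ ^ 2) :=
      mul_le_mul_of_nonneg_right hs (by positivity)
    nlinarith
  have h16 : 64 * (s ^ 3 * ℓ) ≤ s * (s ^ 3 * ℓ) := mul_le_mul_of_nonneg_right hs (by positivity)
  have h17 : 1 ≤ s ^ 4 * ℓ := one_le_mul_of_one_le_of_one_le (one_le_pow₀ (by linarith)) hℓ
  nlinarith

/-- The subexponential correction to the achievability exponent. -/
def overhead (c d n : ℕ) : ℝ :=
  (d : ℝ) + (c : ℝ) * Real.log ((n : ℝ) + 1) + 32 * (n : ℝ) ^ ((4 : ℝ) / 5) *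
    (d : ℝ) ^ ((1 : ℝ) / 5) * Real.log ((d : ℝ) * ((n : ℝ) + (d : ℝ)))

section
variable {c d n : ℕ}

theorem overhead_lower :
    32 * (n : ℝ) ^ ((4 : ℝ) / 5) * (d : ℝ) ^ ((1 : ℝ) / 5) *
      Real.log ((d : ℝ) * ((n : ℝ) + (d : ℝ))) ≤ overhead c d n := by
  have h1 : 0 ≤ Real.log ((n : ℝ) + 1) :=
    Real.log_nonneg (by linarith [(Nat.cast_nonneg n : (0 : ℝ) ≤ n)])
  have h2 : 0 ≤ (c : ℝ) * Real.log ((n : ℝ) + 1) := by positivity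
  rw [overhead]
  linarith [(Nat.cast_nonneg d : (0 : ℝ) ≤ d)]

theorem mul_log_le_overhead (hd : 1 ≤ d) (hn : 1 ≤ n) (h : (n : ℝ) ≤ 64 ^ 5 * d) :
    n * Real.log d ≤ overhead c d n := by
  refine le_trans ?_ overhead_lower
  have hd' : (1 : ℝ) ≤ d := by exact_mod_cast hd
  have hn' : (1 : ℝ) ≤ n := by exact_mod_cast hn
  have hld := Real.log_nonneg hd'
  have h1 : 2 * Real.log d ≤ Real.log ((d : ℝ) * ((n : ℝ) + (d : ℝ))) := by
    rw [two_mul, ← Real.log_mul (by positivity) (by positivity)]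
    exact Real.log_le_log (by positivity) (by nlinarith)
  have h2 : (n : ℝ) ^ ((1 : ℝ) / 5) ≤ 64 * (d : ℝ) ^ ((1 : ℝ) / 5) := by
    have h3 := Real.rpow_le_rpow (by positivity) h (show (0 : ℝ) ≤ 1 / 5 by norm_num)
    rw [Real.mul_rpow (by norm_num) (by positivity)] at h3
    have h4 : ((64 : ℝ) ^ 5) ^ ((1 : ℝ) / 5) = 64 := by
      rw [← Real.rpow_natCast, ← Real.rpow_mul (by norm_num)]
      norm_num
    rwa [h4] at h3
  have h5 : (n : ℝ) = (n : ℝ) ^ ((4 : ℝ) / 5) * (n : ℝ) ^ ((1 : ℝ) / 5) := by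
    rw [← Real.rpow_add (by positivity)]
    norm_num
  have h6 : (n : ℝ) ≤ (n : ℝ) ^ ((4 : ℝ) / 5) * (64 * (d : ℝ) ^ ((1 : ℝ) / 5)) := by
    conv_lhs => rw [h5]
    exact mul_le_mul_of_nonneg_left h2 (by positivity)
  have h7 := mul_le_mul h6 (show Real.log d ≤ Real.log ((d : ℝ) * ((n : ℝ) + (d : ℝ))) / 2 by
    linarith) hld (by positivity)
  linarith

theorem block_error_le_overhead (hd : 1 ≤ d) (h : 64 ^ 5 * (d : ℝ) < n) {m : ℕ}
    (hm : m = ⌈((n : ℝ) ^ ((1 : ℝ) / 5)) ^ 2⌉₊) {L : ℝ}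
    (hL : L = m * Real.log d + Real.log (n + 1)) :
    1 + ((n / m + 1 : ℕ) : ℝ) * (1 + Real.log (n + 1) + (L + 1) / n + Real.log (L + 1)) +
      2 * √(2 * (((n / m + 1 : ℕ) : ℝ) * (4 * (L + 1) ^ 2 + 32))) + Real.log 4 ≤
      overhead c d n := by
  have hd' : (1 : ℝ) ≤ d := by exact_mod_cast hd
  have hn' : (64 : ℝ) ^ 5 ≤ n := by nlinarith
  have hn0 : (0 : ℝ) < n := by linarith [show (0 : ℝ) < 64 ^ 5 by norm_num]
  refine le_trans ?_ overhead_lower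
  set s := (n : ℝ) ^ ((1 : ℝ) / 5) with hs
  set ℓ := Real.log ((d : ℝ) * ((n : ℝ) + (d : ℝ))) with hℓ
  have hs0 : 0 < s := by positivity
  have hs5 : s ^ 5 = n := by
    rw [hs, ← Real.rpow_natCast, ← Real.rpow_mul hn0.le]
    norm_num
  have hs4 : s ^ 4 = (n : ℝ) ^ ((4 : ℝ) / 5) := by
    rw [hs, ← Real.rpow_natCast, ← Real.rpow_mul hn0.le]
    norm_num
  have hs64 : 64 ≤ s := by
    by_contra hc
    have := pow_lt_pow_left₀ (not_le.mp hc) hs0.le (n := 5) (by norm_num)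
    linarith
  have hlogd : Real.log d ≤ ℓ := Real.log_le_log (by positivity) (by nlinarith)
  have hlogd0 := Real.log_nonneg hd'
  have hv : Real.log (n + 1) ≤ ℓ := Real.log_le_log (by positivity) (by nlinarith)
  have hℓ1 : 1 ≤ ℓ := by
    refine le_trans ?_ hv
    rw [Real.le_log_iff_exp_le (by positivity)]
    have := Real.exp_one_lt_d9
    have : (3 : ℝ) ≤ 64 ^ 5 := by norm_num
    linarith
  have hlogn0 : 0 ≤ Real.log ((n : ℝ) + 1) := Real.log_nonneg (by linarith)
  have hm1 : s ^ 2 ≤ m := by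
    rw [hm]
    exact Nat.le_ceil _
  have hm2 : (m : ℝ) ≤ s ^ 2 + 1 := by
    rw [hm]
    exact (Nat.ceil_lt_add_one (by positivity)).le
  have hs2 : (64 : ℝ) ^ 2 ≤ s ^ 2 := pow_le_pow_left₀ (by norm_num) hs64 2
  have hs3 : (64 : ℝ) ^ 3 ≤ s ^ 3 := pow_le_pow_left₀ (by norm_num) hs64 3
  have hk : ((n / m + 1 : ℕ) : ℝ) ≤ 2 * s ^ 3 := by
    have h1 : ((n / m : ℕ) : ℝ) ≤ s ^ 3 := by
      refine Nat.cast_div_le.trans ?_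
      rw [div_le_iff₀ (by nlinarith), ← hs5]
      calc s ^ 5 = s ^ 3 * s ^ 2 := by ring
        _ ≤ _ := mul_le_mul_of_nonneg_left hm1 (by positivity)
    push_cast at h1 ⊢
    linarith
  have hL0 : 0 ≤ L := by
    rw [hL]
    positivity
  have hL3 : L + 1 ≤ 3 * s ^ 2 * ℓ := by
    have h1 : (m : ℝ) * Real.log d ≤ (s ^ 2 + 1) * ℓ := mul_le_mul hm2 hlogd hlogd0 (by positivity)
    rw [hL]
    nlinarith
  have hb := block_error_le hs64 hℓ1 hk (Nat.cast_nonneg _) hL0 hL3 hv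
    (by rw [hs5]; exact Real.log_le_log hn0 (by linarith))
  rw [hs5] at hb
  have h4 : Real.log 4 ≤ 2 := by
    rw [Real.log_le_iff_le_exp (by norm_num)]
    have h1 := Real.add_one_le_exp (1 : ℝ)
    have h2 : Real.exp 2 = Real.exp 1 * Real.exp 1 := by
      rw [← Real.exp_add]
      norm_num
    nlinarith
  have h5 : 32 * s ^ 4 * 1 * ℓ ≤ 32 * s ^ 4 * (d : ℝ) ^ ((1 : ℝ) / 5) * ℓ := by
    gcongr
    exact Real.one_le_rpow hd' (by norm_num)
  rw [← hs4]
  linarith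

end

section
variable {X : Type*} [Fintype X] [Nonempty X] {d : ℕ} {W : X → Matrix (Fin d) (Fin d) ℂ}

theorem bddBelow_range_exp {ι : Sort*} (f : ι → ℝ) :
    BddBelow (Set.range fun i => Real.exp (f i)) :=
  ⟨0, by rintro _ ⟨i, rfl⟩; exact (Real.exp_pos _).le⟩

theorem half_exp_mul_iInf_le (hW : ∀ x, IsDensity (W x)) {r : ℝ} (hr : 0 ≤ r) {n : ℕ}
    (hn : d ≤ n) :
    (1 / 2 : ℝ) * Real.exp (-overhead (Fintype.card X) d n) *
      (⨅ α : {a : ℝ // 1 / 2 ≤ a ∧ a ≤ 1},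
          Real.exp (-(n : ℝ) * ((1 - α.1) / α.1) * ((sandMI α.1 W).toReal - r))) ≤
      1 - qEpsNS (cqPow W n) (Real.exp (n * r)) := by
  have hd : 1 ≤ d := by
    simpa [Nat.one_le_iff_ne_zero, Nat.pos_iff_ne_zero] using (hW (Classical.arbitrary X)).card_pos
  have hd' : (0 : ℝ) < d := by exact_mod_cast hd
  have hn1 : 1 ≤ n := hd.trans hn
  have hbdd := bddBelow_range_exp fun α : {a : ℝ // 1 / 2 ≤ a ∧ a ≤ 1} =>
    -(n : ℝ) * ((1 - α.1) / α.1) * ((sandMI α.1 W).toReal - r)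
  set I := ⨅ α : {a : ℝ // 1 / 2 ≤ a ∧ a ≤ 1},
    Real.exp (-(n : ℝ) * ((1 - α.1) / α.1) * ((sandMI α.1 W).toReal - r)) with hI
  have hI0 : 0 ≤ I := Real.iInf_nonneg fun _ => (Real.exp_pos _).le
  have hI1 : I ≤ 1 := (ciInf_le hbdd ⟨1, by norm_num, le_rfl⟩).trans_eq (by simp)
  set A := overhead (Fintype.card X) d n with hA
  have hA0 : 0 ≤ A := by
    have h1 : (1 : ℝ) ≤ (d : ℝ) * ((n : ℝ) + (d : ℝ)) := by
      exact_mod_cast Nat.one_le_iff_ne_zero.mpr (by positivity)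
    have h2 := Real.log_nonneg h1
    exact le_trans (by positivity) overhead_lower
  have hF0 : 0 ≤ Real.exp (-A) * I := by positivity
  have hF1 : Real.exp (-A) * I ≤ 1 :=
    mul_le_one₀ (Real.exp_le_one_iff.mpr (by linarith)) hI0 hI1
  have key : ∃ σ : Matrix (Fin n → Fin d) (Fin n → Fin d) ℂ, IsDensity σ ∧ ∀ xs, ∃ w,
      IsDensity w ∧ (Real.exp (n * r) • σ - w).PosSemidef ∧
        Real.exp (-A) * I ≤ qFid (cqPow W n xs) w := by
    rcases le_or_gt (n : ℝ) (64 ^ 5 * d) with h | h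
    · have hc : 0 < Fintype.card (Fin n → Fin d) := by
        simp only [Fintype.card_fun, Fintype.card_fin]
        positivity
      have hσ := isDensity_mixedState hc
      refine ⟨mixedState _, hσ, fun xs => ⟨mixedState _, hσ, ?_, ?_⟩⟩
      · have h1 := posSemidef_real_smul hσ.1 (sub_nonneg.mpr
          (Real.one_le_exp (show 0 ≤ (n : ℝ) * r by positivity)))
        rwa [sub_smul, one_smul] at h1
      · refine le_trans ?_ (inv_card_le_qFid_mixedState (cqPow_isDensity hW xs))
        refine (mul_le_of_le_one_right (Real.exp_pos _).le hI1).trans ?_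
        simp only [Fintype.card_fun, Fintype.card_fin]
        push_cast
        rw [Real.exp_neg]
        refine inv_anti₀ (by positivity) ?_
        rw [← Real.exp_log (pow_pos hd' n), Real.log_pow]
        exact Real.exp_le_exp.mpr (mul_log_le_overhead hd hn1 h)
    · obtain ⟨m, hm⟩ : ∃ m, m = ⌈((n : ℝ) ^ ((1 : ℝ) / 5)) ^ 2⌉₊ := ⟨_, rfl⟩
      have hn0 : (0 : ℝ) < n := by exact_mod_cast hn1
      have hm0 : 0 < m := by
        rw [hm]
        exact Nat.ceil_pos.mpr (by positivity)
      obtain ⟨σ, hσ, hsim⟩ := exists_simulation_cqPow hW hr hn1 (blockIndex n m)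
        (card_blockIndex_le hm0) rfl
      refine ⟨σ, hσ, fun xs => ?_⟩
      obtain ⟨w, hw, hwσ, α, hα, hα1, hF⟩ := hsim xs
      refine ⟨w, hw, hwσ, le_trans ?_ hF⟩
      have h1 : I ≤ _ := ciInf_le hbdd ⟨α, hα, hα1⟩
      refine (mul_le_mul_of_nonneg_left h1 (Real.exp_pos _).le).trans ?_
      have h2 := block_error_le_overhead (c := Fintype.card X) hd h hm rfl
      rw [le_div_iff₀ (by norm_num), ← Real.exp_add]
      refine (mul_le_mul_of_nonneg_left (Real.exp_log (show (0 : ℝ) < 4 by norm_num)).ge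
        (Real.exp_pos _).le).trans ?_
      rw [← Real.exp_add]
      refine Real.exp_le_exp.mpr ?_
      linarith
  obtain ⟨σ, hσ, hsim⟩ := key
  have : Nonempty (Fin n → X) := inferInstance
  have h1 := half_le_one_sub_qEpsNS hσ hF0 hsim
  rw [min_eq_left hF1] at h1
  linarith

theorem bddAbove_exponent (hW : ∀ x, IsDensity (W x)) {r : ℝ} (hr : 0 ≤ r) :
    BddAbove (Set.range fun α : {a : ℝ // 1 / 2 ≤ a ∧ a ≤ 1} =>
      ((1 - α.1) / α.1) * ((sandMI α.1 W).toReal - r)) := by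
  have hd : 1 ≤ d := by
    simpa [Nat.one_le_iff_ne_zero, Nat.pos_iff_ne_zero] using (hW (Classical.arbitrary X)).card_pos
  have hlog : 0 ≤ Real.log d := Real.log_nonneg (by exact_mod_cast hd)
  refine ⟨Real.log d, ?_⟩
  rintro _ ⟨⟨α, hα, hα1⟩, rfl⟩
  rcases hα1.lt_or_eq with h | rfl
  · obtain ⟨v, hv, hvd⟩ := exists_sandMI_eq hW hα h
    rw [Fintype.card_fin] at hvd
    simp only [hv, EReal.toReal_coe]
    have h0 : 0 ≤ (1 - α) / α := div_nonneg (by linarith) (by linarith)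
    have h1 : (1 - α) / α ≤ 1 := (div_le_one (by linarith)).mpr (by linarith)
    refine (mul_le_mul_of_nonneg_left (show v - r ≤ Real.log d by linarith) h0).trans ?_
    exact mul_le_of_le_one_left hlog h1
  · simpa using hlog

theorem overhead_div_le (c : ℕ) {d n : ℕ} (hd : 1 ≤ d) (hn : d ≤ n) :
    (overhead c d n + Real.log 2) / n ≤
      (d + Real.log 2 + c * Real.log 2 + 32 * (d : ℝ) ^ ((1 : ℝ) / 5) * Real.log (2 * d)) *
          (n : ℝ) ^ (-((1 : ℝ) / 5)) +
        (c + 32 * (d : ℝ) ^ ((1 : ℝ) / 5)) * (Real.log n / (n : ℝ) ^ ((1 : ℝ) / 5)) := by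
  have hd' : (1 : ℝ) ≤ d := by exact_mod_cast hd
  have hn' : (d : ℝ) ≤ n := by exact_mod_cast hn
  have hn0 : (0 : ℝ) < n := by linarith
  have hln : 0 ≤ Real.log n := Real.log_nonneg (by linarith)
  have hl2 : 0 ≤ Real.log 2 := Real.log_nonneg (by norm_num)
  have h1 : Real.log ((n : ℝ) + 1) ≤ Real.log 2 + Real.log n := by
    rw [← Real.log_mul (by norm_num) hn0.ne']
    exact Real.log_le_log (by linarith) (by linarith)
  have h2 : Real.log ((d : ℝ) * ((n : ℝ) + d)) ≤ Real.log (2 * d) + Real.log n := by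
    rw [← Real.log_mul (by positivity) hn0.ne']
    exact Real.log_le_log (by positivity) (by nlinarith)
  set s := (n : ℝ) ^ ((1 : ℝ) / 5) with hs
  have hs1 : 1 ≤ (n : ℝ) ^ ((4 : ℝ) / 5) := Real.one_le_rpow (by linarith) (by norm_num)
  have hns : (n : ℝ) = (n : ℝ) ^ ((4 : ℝ) / 5) * s := by
    rw [hs, ← Real.rpow_add hn0]
    norm_num
  have hs0 : 0 < s := by positivity
  set q := (n : ℝ) ^ ((4 : ℝ) / 5)
  set δ := (d : ℝ) ^ ((1 : ℝ) / 5) with hδ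
  have hδ0 : 0 ≤ δ := by positivity
  rw [Real.rpow_neg hn0.le, ← hs, hns, div_le_iff₀ (by positivity), overhead, ← hδ]
  have h3 : ((d + Real.log 2 + c * Real.log 2 + 32 * δ * Real.log (2 * d)) * s⁻¹ +
      (c + 32 * δ) * (Real.log (q * s) / s)) * (q * s) =
      q * (d + Real.log 2 + c * (Real.log 2 + Real.log (q * s))) +
        32 * q * δ * (Real.log (2 * d) + Real.log (q * s)) := by
    field_simp
    ring
  rw [h3, ← hns]
  have h4 : (c : ℝ) * Real.log ((n : ℝ) + 1) ≤ c * (Real.log 2 + Real.log n) :=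
    mul_le_mul_of_nonneg_left h1 (Nat.cast_nonneg c)
  have h5 : 32 * q * δ * Real.log ((d : ℝ) * ((n : ℝ) + d)) ≤
      32 * q * δ * (Real.log (2 * d) + Real.log n) :=
    mul_le_mul_of_nonneg_left h2 (by positivity)
  have h6 : 1 * (d + Real.log 2 + c * (Real.log 2 + Real.log n)) ≤
      q * (d + Real.log 2 + c * (Real.log 2 + Real.log n)) :=
    mul_le_mul_of_nonneg_right hs1 (by positivity)
  linarith

theorem tendsto_overhead_div (c : ℕ) {d : ℕ} (hd : 1 ≤ d) :
    Filter.Tendsto (fun n : ℕ => (overhead c d n + Real.log 2) / n) Filter.atTop (nhds 0) := by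
  have h1 : Filter.Tendsto (fun n : ℕ => (n : ℝ) ^ (-((1 : ℝ) / 5))) Filter.atTop (nhds 0) :=
    (tendsto_rpow_neg_atTop (by norm_num)).comp tendsto_natCast_atTop_atTop
  have h2 : Filter.Tendsto (fun n : ℕ => Real.log n / (n : ℝ) ^ ((1 : ℝ) / 5)) Filter.atTop
      (nhds 0) :=
    ((isLittleO_log_rpow_atTop (r := 1 / 5) (by norm_num)).tendsto_div_nhds_zero).comp
      tendsto_natCast_atTop_atTop
  have h3 := (h1.const_mul (d + Real.log 2 + c * Real.log 2 +
    32 * (d : ℝ) ^ ((1 : ℝ) / 5) * Real.log (2 * d))).add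
      (h2.const_mul (c + 32 * (d : ℝ) ^ ((1 : ℝ) / 5)))
  simp only [mul_zero, add_zero] at h3
  refine tendsto_of_tendsto_of_tendsto_of_le_of_le' tendsto_const_nhds h3 ?_ ?_
  · refine Filter.Eventually.of_forall fun n => ?_
    have h4 : 0 ≤ Real.log ((d : ℝ) * ((n : ℝ) + (d : ℝ))) := Real.log_nonneg (by
      exact_mod_cast Nat.one_le_iff_ne_zero.mpr (by positivity))
    have h5 : 0 ≤ overhead c d n := le_trans (by positivity) overhead_lower
    have h6 : 0 ≤ Real.log 2 := Real.log_nonneg (by norm_num)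
    positivity
  · filter_upwards [Filter.eventually_ge_atTop d] with n hn
    exact overhead_div_le c hd hn

theorem limsup_exponent_le (hW : ∀ x, IsDensity (W x)) {r : ℝ} (hr : 0 ≤ r) :
    Filter.limsup
      (fun n : ℕ => -(1 / (n : ℝ)) *
        Real.log (1 - qEpsNS (cqPow W n) (Real.exp (n * r)))) Filter.atTop ≤
    ⨆ α : {a : ℝ // 1 / 2 ≤ a ∧ a ≤ 1},
      ((1 - α.1) / α.1) * ((sandMI α.1 W).toReal - r) := by
  have hd : 1 ≤ d := by
    simpa [Nat.one_le_iff_ne_zero, Nat.pos_iff_ne_zero] using (hW (Classical.arbitrary X)).card_pos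
  have hbdd := bddAbove_exponent hW hr
  set G := ⨆ α : {a : ℝ // 1 / 2 ≤ a ∧ a ≤ 1},
      ((1 - α.1) / α.1) * ((sandMI α.1 W).toReal - r) with hG
  have hne : Nonempty {a : ℝ // 1 / 2 ≤ a ∧ a ≤ 1} := ⟨⟨1, by norm_num, le_rfl⟩⟩
  have hlim : Filter.Tendsto (fun n : ℕ => G + (overhead (Fintype.card X) d n + Real.log 2) / n)
      Filter.atTop (nhds G) := by
    simpa using tendsto_const_nhds.add (tendsto_overhead_div (Fintype.card X) hd)
  have hlow : ∀ n : ℕ, d ≤ n → Real.exp (-(n * G + overhead (Fintype.card X) d n + Real.log 2)) ≤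
      1 - qEpsNS (cqPow W n) (Real.exp (n * r)) := by
    intro n hn
    refine le_trans ?_ (half_exp_mul_iInf_le hW hr hn)
    have h1 : Real.exp (-(n * G)) ≤ ⨅ α : {a : ℝ // 1 / 2 ≤ a ∧ a ≤ 1},
        Real.exp (-(n : ℝ) * ((1 - α.1) / α.1) * ((sandMI α.1 W).toReal - r)) := by
      refine le_ciInf fun α => Real.exp_le_exp.mpr ?_
      have h2 := mul_le_mul_of_nonneg_left (le_ciSup hbdd α) (Nat.cast_nonneg (α := ℝ) n)
      linarith
    have h3 : Real.exp (-(n * G + overhead (Fintype.card X) d n + Real.log 2)) =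
        1 / 2 * Real.exp (-overhead (Fintype.card X) d n) * Real.exp (-(n * G)) := by
      have h4 : (1 / 2 : ℝ) = Real.exp (-Real.log 2) := by
        rw [Real.exp_neg, Real.exp_log (by norm_num), one_div]
      rw [h4, ← Real.exp_add, ← Real.exp_add]
      congr 1
      ring
    rw [h3]
    exact mul_le_mul_of_nonneg_left h1 (by positivity)
  refine (Filter.limsup_le_limsup ?_ ?_ hlim.isBoundedUnder_le).trans_eq hlim.limsup_eq
  · filter_upwards [Filter.eventually_ge_atTop d] with n hn
    have hn0 : (0 : ℝ) < n := by exact_mod_cast hd.trans hn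
    have h1 := Real.log_le_log (Real.exp_pos _) (hlow n hn)
    rw [Real.log_exp] at h1
    have h2 : G + (overhead (Fintype.card X) d n + Real.log 2) / n =
        1 / (n : ℝ) * (n * G + overhead (Fintype.card X) d n + Real.log 2) := by
      field_simp
      ring
    rw [h2, neg_mul, ← mul_neg]
    exact mul_le_mul_of_nonneg_left (by linarith) (by positivity)
  · refine Filter.IsBoundedUnder.isCoboundedUnder_le ⟨0, ?_⟩
    rw [Filter.eventually_map]
    filter_upwards [Filter.eventually_ge_atTop d] with n hn
    have h1 := (Real.exp_pos _).trans_le (hlow n hn)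
    have h2 := qEpsNS_nonneg (cqPow W n) (Real.exp (n * r))
    have h3 := Real.log_nonpos h1.le (by linarith)
    exact mul_nonneg_of_nonpos_of_nonpos (neg_nonpos.mpr (by positivity)) h3

end

end ChannelSim

open ChannelSim in
/-- achievability of the strong converse exponent for non-signaling assisted
classical-quantum channel simulation. -/
theorem statement6 {X : Type*} [Fintype X] [Nonempty X] {d : ℕ}
    (W : X → Matrix (Fin d) (Fin d) ℂ) (hW : ∀ x, IsDensity (W x))
    (r : ℝ) (hr : 0 ≤ r) :
    (∀ n : ℕ, d ≤ n →
      (1 / 2 : ℝ) * Real.exp (-(d : ℝ) - (Fintype.card X : ℝ) * Real.log ((n : ℝ) + 1)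
          - 32 * (n : ℝ) ^ ((4 : ℝ) / 5) * (d : ℝ) ^ ((1 : ℝ) / 5) *
            Real.log ((d : ℝ) * ((n : ℝ) + (d : ℝ)))) *
        (⨅ α : {a : ℝ // 1 / 2 ≤ a ∧ a ≤ 1},
          Real.exp (-(n : ℝ) * ((1 - α.1) / α.1) * ((sandMI α.1 W).toReal - r))) ≤
      1 - qEpsNS (cqPow W n) (Real.exp (n * r))) ∧
    Filter.limsup
      (fun n : ℕ => -(1 / (n : ℝ)) *
        Real.log (1 - qEpsNS (cqPow W n) (Real.exp (n * r)))) Filter.atTop ≤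
    ⨆ α : {a : ℝ // 1 / 2 ≤ a ∧ a ≤ 1},
      ((1 - α.1) / α.1) * ((sandMI α.1 W).toReal - r) := by
  refine ⟨fun n hn => ?_, limsup_exponent_le hW hr⟩
  refine le_of_eq_of_le ?_ (half_exp_mul_iInf_le hW hr hn)
  congr 3
  rw [overhead]
  ring
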